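/- arXiv:math/0607396 — 2 statements merged into one kernel-verified Lean document; each statement's English description precedes it below -/
import Mathlib

section
/- The f-vector of the d-braxtope Q^{d,n} (n ≥ d ≥ 3) satisfies f_j(Q^{d,n}) = C(d+1, j+1) + (n-d)[C(d-1, j) + C(d-2, j-1)] for -1 ≤ j ≤ d, where f_j denotes the number of j-dimensional faces and C denotes the binomial coefficient. -/
open Set

noncomputable section

variable {V : Type*} [NormedAddCommGroup V] [NormedSpace ℝ V]

open Classical in
/-- Affine dimension of a set: `-1` for the empty set, otherwise the
dimension of its affine hull. -/
def sdim (s : Set V) : ℤ :=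
  if s.Nonempty then (Module.finrank ℝ (affineSpan ℝ s).direction : ℤ) else -1

/-- `F` is a face of the polytope `Q`. -/
def IsFaceOf (Q F : Set V) : Prop :=
  IsExtreme ℝ Q F ∧ Convex ℝ F ∧ IsClosed F

/-- `F` is a facet of the `d`-polytope `Q`. -/
def IsFacetOf (d : ℕ) (Q F : Set V) : Prop :=
  IsFaceOf Q F ∧ sdim F = (d : ℤ) - 1

/-- The segment `[a, b]` is an edge (a 1-dimensional face) of `Q`. -/
def IsEdgeOf (Q : Set V) (a b : V) : Prop :=
  IsFaceOf Q (segment ℝ a b) ∧ sdim (segment ℝ a b) = 1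

/-- Clamped vertex indexing: `x_t = x_0` for `t ≤ 0` and `x_t = x_n` for `t ≥ n`. -/
def xc {n : ℕ} (x : Fin (n + 1) → V) (t : ℤ) : V :=
  x ⟨(min (max t 0) n).toNat, by omega⟩

/-- The polytope spanned by the vertex array `x`. -/
def braxQ {n : ℕ} (x : Fin (n + 1) → V) : Set V :=
  convexHull ℝ (Set.range x)

/-- Vertex set of the simplex facet `T_i = [x_i, …, x_{i+d-1}]`. -/
def Tset (d : ℕ) {n : ℕ} (x : Fin (n + 1) → V) (i : ℤ) : Set V :=
  xc x '' Set.Icc i (i + (d : ℤ) - 1)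

/-- Vertex set of the facet
`E_j = [x_0, x_{j-(d-2)}, …, x_{j-1}, x_{j+1}, …, x_{j+(d-2)}]`. -/
def Eset (d : ℕ) {n : ℕ} (x : Fin (n + 1) → V) (j : ℤ) : Set V :=
  insert (x 0) (xc x '' (Set.Icc (j - ((d : ℤ) - 2)) (j + ((d : ℤ) - 2)) \ {j}))

/-- `x_0 < x_1 < ⋯ < x_n` is the vertex array of a `d`-braxtope: for `d ≤ 2` a
`d`-simplex; for `d ≥ 3` a `d`-polytope whose facets are exactly the `T_i`
(`0 ≤ i ≤ n - d + 1`) and the `E_j` (`2 ≤ j ≤ n`). -/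
def IsBraxtope (d n : ℕ) (x : Fin (n + 1) → V) : Prop :=
  (d ≤ 2 → n = d ∧ AffineIndependent ℝ x) ∧
  (3 ≤ d →
    d ≤ n ∧ Function.Injective x ∧
    sdim (braxQ x) = d ∧
    (∀ i, x i ∈ Set.extremePoints ℝ (braxQ x)) ∧
    (∀ F : Set V, IsFacetOf d (braxQ x) F ↔
      (∃ i : ℤ, 0 ≤ i ∧ i ≤ (n : ℤ) - d + 1 ∧ F = convexHull ℝ (Tset d x i)) ∨
      (∃ j : ℤ, 2 ≤ j ∧ j ≤ (n : ℤ) ∧ F = convexHull ℝ (Eset d x j))))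


/-- Binomial coefficient `C(a, b)` for integer arguments (zero when `b < 0`). -/
def zchoose (a b : ℤ) : ℤ := if 0 ≤ b then (a.toNat.choose b.toNat : ℤ) else 0


/-! ### Part 1: general polytope geometry -/

theorem farkas_aux {ι : Type*} (S : Finset ι) : ∀ (y : ι → V) (w : V),
    (∃ c : ι → ℝ, (∀ k ∈ S, 0 ≤ c k) ∧ w = ∑ k ∈ S, c k • y k) ∨
    (∃ f : V →ₗ[ℝ] ℝ, (∀ k ∈ S, f (y k) ≤ 0) ∧ 0 < f w) := by
  classical
  induction S using Finset.induction_on with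
  | empty =>
    intro y w
    by_cases hw : w = 0
    · left; exact ⟨0, by simp, by simp [hw]⟩
    · right
      have : w ∉ (⊥ : Submodule ℝ V) := by simpa using hw
      obtain ⟨f, hf, -⟩ := Submodule.exists_le_ker_of_notMem this
      rcases lt_or_gt_of_ne hf with h | h
      · exact ⟨-f, by simp, by simpa using h⟩
      · exact ⟨f, by simp, h⟩
  | insert a S ha ih =>
    intro y w
    rcases ih y w with ⟨c, hc, hw⟩ | ⟨f, hf, hfw⟩
    · left
      refine ⟨fun k => if k = a then 0 else c k, ?_, ?_⟩
      · intro k hk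
        by_cases h : k = a
        · simp [h]
        · simp only [h, if_false]
          exact hc k ((Finset.mem_insert.1 hk).resolve_left h)
      · rw [Finset.sum_insert ha, hw]
        simp only [if_true, zero_smul, zero_add]
        refine Finset.sum_congr rfl fun k hk => ?_
        have : k ≠ a := fun h => ha (h ▸ hk)
        simp [this]
    · by_cases hfa : f (y a) ≤ 0
      · right
        refine ⟨f, ?_, hfw⟩
        intro k hk
        rcases Finset.mem_insert.1 hk with rfl | hk
        · exact hfa
        · exact hf k hk
      · push Not at hfa
        rcases ih (fun k => y k - (f (y k) / f (y a)) • y a) (w - (f w / f (y a)) • y a) with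
          ⟨c, hc, hw⟩ | ⟨g, hg, hgw⟩
        · left
          refine ⟨fun k => if k = a then f w / f (y a) - ∑ k ∈ S, c k * (f (y k) / f (y a))
            else c k, ?_, ?_⟩
          · intro k hk
            by_cases h : k = a
            · simp only [h, if_true]
              have h1 : ∑ k ∈ S, c k * (f (y k) / f (y a)) ≤ 0 := by
                refine Finset.sum_nonpos fun k hk => ?_
                exact mul_nonpos_of_nonneg_of_nonpos (hc k hk)
                  (div_nonpos_of_nonpos_of_nonneg (hf k hk) hfa.le)
              have h2 : 0 < f w / f (y a) := div_pos hfw hfa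
              linarith
            · simp only [h, if_false]
              exact hc k ((Finset.mem_insert.1 hk).resolve_left h)
          · rw [Finset.sum_insert ha]
            have h1 : ∑ k ∈ S, (if k = a then f w / f (y a) - ∑ k ∈ S, c k * (f (y k) / f (y a))
                else c k) • y k = ∑ k ∈ S, c k • y k := by
              refine Finset.sum_congr rfl fun k hk => ?_
              have : k ≠ a := fun h => ha (h ▸ hk)
              simp [this]
            rw [h1]
            simp only [smul_sub, Finset.sum_sub_distrib, smul_smul, ← Finset.sum_smul] at hw
            simp only [if_true, sub_smul]
            rw [sub_eq_iff_eq_add] at hw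
            refine hw.trans ?_
            abel
        · right
          refine ⟨g - ((g (y a)) / f (y a)) • f, ?_, ?_⟩
          · intro k hk
            rcases Finset.mem_insert.1 hk with rfl | hk
            · simp [hfa.ne']
            · have := hg k hk
              simp only [map_sub, map_smul, smul_eq_mul] at this
              simp only [LinearMap.sub_apply, LinearMap.smul_apply, smul_eq_mul]
              calc _ = _ := by ring
                _ ≤ 0 := this
          · simp only [map_sub, map_smul, smul_eq_mul] at hgw
            simp only [LinearMap.sub_apply, LinearMap.smul_apply, smul_eq_mul]
            calc 0 < _ := hgw
              _ = _ := by ring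

open Classical in
/-- A convex extreme subset of a polytope is the hull of the vertices it contains. -/
theorem face_eq_hull {ι : Type*} (S : Finset ι) (y : ι → V) (F : Set V)
    (hE : IsExtreme ℝ (convexHull ℝ (y '' S)) F) (hF : Convex ℝ F) :
    F = convexHull ℝ (y '' (S.filter (fun k => y k ∈ F) : Finset ι)) := by
  have hI : convexHull ℝ (y '' (S.filter (fun k => y k ∈ F) : Finset ι)) ⊆ F := by
    refine convexHull_min ?_ hF
    rintro _ ⟨k, hk, rfl⟩
    simp at hk
    exact hk.2
  have hJ : convexHull ℝ (y '' (S.filter (fun k => ¬ y k ∈ F) : Finset ι)) ⊆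
      convexHull ℝ (y '' S) \ F := by
    refine convexHull_min ?_ (hE.convex_sdiff (convex_convexHull ℝ _))
    rintro _ ⟨k, hk, rfl⟩
    simp at hk
    exact ⟨subset_convexHull _ _ ⟨k, hk.1, rfl⟩, hk.2⟩
  have hU : y '' S = y '' (S.filter (fun k => y k ∈ F) : Finset ι) ∪
      y '' (S.filter (fun k => ¬ y k ∈ F) : Finset ι) := by
    rw [← Set.image_union, ← Finset.coe_union, Finset.filter_union_filter_not_eq]
  refine Subset.antisymm ?_ hI
  intro z hz
  rcases (y '' (S.filter (fun k => y k ∈ F) : Finset ι)).eq_empty_or_nonempty with h1 | h1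
  · rw [h1, empty_union] at hU
    rw [← hU] at hJ
    exact absurd hz (hJ (hE.1 hz)).2
  rcases (y '' (S.filter (fun k => ¬ y k ∈ F) : Finset ι)).eq_empty_or_nonempty with h2 | h2
  · rw [h2, union_empty] at hU
    rw [← hU]
    exact hE.1 hz
  have hzQ := hE.1 hz
  rw [hU, convexHull_union h1 h2, mem_convexJoin] at hzQ
  obtain ⟨u, hu, v, hv, hzuv⟩ := hzQ
  rw [← insert_endpoints_openSegment] at hzuv
  rcases hzuv with rfl | rfl | h
  · exact hu
  · exact absurd hz (hJ hv).2
  · exact absurd (hE.right_mem_of_mem_openSegment (hE.1 (hI hu)) (hJ hv).1 hz h) (hJ hv).2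

open Classical in
/-- Separation of a face from a vertex outside it. -/
theorem exists_support {ι : Type*} (S : Finset ι) (y : ι → V) (F : Set V)
    (hE : IsExtreme ℝ (convexHull ℝ (y '' S)) F) (hF : Convex ℝ F) (i : ι) (hi : i ∈ S)
    (hiF : y i ∉ F) :
    ∃ (f : V →ₗ[ℝ] ℝ) (c : ℝ), (∀ k ∈ S, f (y k) ≤ c) ∧ (∀ z ∈ F, f z = c) ∧ f (y i) < c := by
  have hFI := face_eq_hull S y F hE hF
  set I := S.filter (fun k => y k ∈ F) with hIdef
  rcases I.eq_empty_or_nonempty with hI0 | hIn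
  · refine ⟨0, 1, by simp, ?_, by simp⟩
    rw [hFI, hI0]; simp
  have hcard : (0 : ℝ) < I.card := by exact_mod_cast hIn.card_pos
  obtain ⟨p, hp⟩ : ∃ p : V, p = ∑ k ∈ I, (1 / (I.card : ℝ)) • y k := ⟨_, rfl⟩
  have hpF : p ∈ F := by
    rw [hp]
    refine hF.sum_mem (fun _ _ => (one_div_pos.2 hcard).le) ?_ ?_
    · rw [Finset.sum_const, nsmul_eq_mul, mul_one_div_cancel hcard.ne']
    · intro k hk; exact (Finset.mem_filter.1 hk).2
  rcases farkas_aux S (fun k => y k - p) (p - y i) with ⟨c, hc, hw⟩ | ⟨f, hf, hfw⟩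
  · exfalso
    apply hiF
    obtain ⟨C, hC⟩ : ∃ C, C = ∑ k ∈ S, c k := ⟨_, rfl⟩
    have hC0 : 0 ≤ C := hC ▸ Finset.sum_nonneg hc
    simp only [smul_sub, Finset.sum_sub_distrib, ← Finset.sum_smul, ← hC] at hw
    obtain ⟨q, hq⟩ : ∃ q : V, q = (1 / (1 + C)) • p + ∑ k ∈ S, (c k / (1 + C)) • y k :=
      ⟨_, rfl⟩
    have hqs : (1 + C) • q = p + ∑ k ∈ S, c k • y k := by
      rw [hq, smul_add, smul_smul, Finset.smul_sum]
      congr 1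
      · rw [mul_one_div_cancel (by positivity), one_smul]
      · refine Finset.sum_congr rfl fun k _ => ?_
        rw [smul_smul, mul_div_cancel₀ _ (by positivity)]
    have hqQ : q ∈ convexHull ℝ (y '' S) := by
      by_cases hC' : C = 0
      · have : ∀ k ∈ S, c k = 0 := (Finset.sum_eq_zero_iff_of_nonneg hc).1 (hC ▸ hC')
        have : q = p := by
          rw [hq, hC', Finset.sum_eq_zero]
          · simp
          · intro k hk; simp [this k hk]
        rw [this]; exact hE.1 hpF
      · have hC1 : 0 < C := lt_of_le_of_ne hC0 (Ne.symm hC')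
        have hr : ∑ k ∈ S, (c k / C) • y k ∈ convexHull ℝ (y '' S) := by
          refine (convex_convexHull ℝ _).sum_mem (fun k hk => div_nonneg (hc k hk) hC0) ?_ ?_
          · rw [← Finset.sum_div, ← hC, div_self hC']
          · intro k hk; exact subset_convexHull _ _ ⟨k, hk, rfl⟩
        have : q = (1 / (1 + C)) • p + (C / (1 + C)) • ∑ k ∈ S, (c k / C) • y k := by
          rw [hq, Finset.smul_sum]
          congr 1
          refine Finset.sum_congr rfl fun k _ => ?_
          rw [smul_smul]
          congr 1
          field_simp
        rw [this]
        refine (convex_convexHull ℝ _) (hE.1 hpF) hr (by positivity) (by positivity) ?_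
        field_simp
    refine hE.left_mem_of_mem_openSegment (subset_convexHull _ _ ⟨i, hi, rfl⟩) hqQ hpF ?_
    refine ⟨1 / (2 + C), (1 + C) / (2 + C), by positivity, by positivity, ?_, ?_⟩
    · field_simp; ring
    · have h1 : (2 + C) • p = y i + (1 + C) • q := by
        rw [hqs, show (2 + C) = 1 + 1 + C by ring, add_smul, add_smul, one_smul]
        rw [sub_eq_iff_eq_add] at hw
        have : p + C • p = ∑ k ∈ S, c k • y k + y i := by
          nth_rewrite 1 [hw]; abel
        rw [add_assoc, this]; abel
      have h2 : p = (1 / (2 + C)) • ((2 + C) • p) := by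
        rw [smul_smul, one_div_mul_cancel (by positivity), one_smul]
      rw [h2, h1, smul_add, smul_smul]
      congr 2
      ring
  · simp only [map_sub] at hf hfw
    refine ⟨f, f p, fun k hk => by linarith [hf k hk], ?_, by linarith⟩
    have hIc : ∀ k ∈ I, f (y k) = f p := by
      by_contra hcon
      push Not at hcon
      obtain ⟨k, hk, hne⟩ := hcon
      have hle : ∀ k ∈ I, f (y k) ≤ f p := fun k hk => by
        linarith [hf k (Finset.mem_filter.1 hk).1]
      have h1 : f p = ∑ k ∈ I, (1 / (I.card : ℝ)) * f (y k) := by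
        rw [hp, map_sum]; simp only [map_smul, smul_eq_mul]
      have h2 : ∑ k ∈ I, (1 / (I.card : ℝ)) * f (y k) < ∑ k ∈ I, (1 / (I.card : ℝ)) * f p := by
        refine Finset.sum_lt_sum (fun k hk => ?_) ⟨k, hk, ?_⟩
        · exact mul_le_mul_of_nonneg_left (hle k hk) (one_div_pos.2 hcard).le
        · exact mul_lt_mul_of_pos_left (lt_of_le_of_ne (hle k hk) hne) (one_div_pos.2 hcard)
      rw [← h1, Finset.sum_const, nsmul_eq_mul, ← mul_assoc, mul_one_div_cancel hcard.ne',
        one_mul] at h2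
      exact lt_irrefl _ h2
    have hsub : F ⊆ {z | f z = f p} := by
      rw [hFI]
      refine convexHull_min ?_ (convex_hyperplane f.isLinear _)
      rintro _ ⟨k, hk, rfl⟩
      exact hIc k hk
    exact fun z hz => hsub hz

theorem sdim_convexHull (s : Set V) : sdim (convexHull ℝ s) = sdim s := by
  unfold sdim
  rw [affineSpan_convexHull, convexHull_nonempty_iff]

theorem sdim_mono {s t : Set V} (ht : t.Finite) (h : s ⊆ t) : sdim s ≤ sdim t := by
  unfold sdim
  by_cases hs : s.Nonempty
  · rw [if_pos hs, if_pos (hs.mono h)]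
    have : FiniteDimensional ℝ (affineSpan ℝ t).direction := by
      rw [direction_affineSpan]; exact finiteDimensional_vectorSpan_of_finite ℝ ht
    exact_mod_cast Submodule.finrank_mono (AffineSubspace.direction_le (affineSpan_mono ℝ h))
  · rw [if_neg hs]
    split_ifs <;> omega

theorem sdim_insert_le (s : Set V) (p : V) : sdim (insert p s) ≤ sdim s + 1 := by
  unfold sdim
  rw [if_pos (insert_nonempty p s)]
  by_cases hs : s.Nonempty
  · rw [if_pos hs]
    have := finrank_vectorSpan_insert_le_set ℝ s p
    rw [direction_affineSpan, direction_affineSpan]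
    exact_mod_cast this
  · rw [if_neg hs, not_nonempty_iff_eq_empty.1 hs]
    have h1 : (insert p ∅ : Set V) = {p} := by ext; simp
    rw [h1, direction_affineSpan, vectorSpan_singleton, finrank_bot]
    norm_num

theorem sdim_insert_eq {s : Set V} (hs : s.Finite) {p : V} (hp : p ∉ affineSpan ℝ s) :
    sdim (insert p s) = sdim s + 1 := by
  refine le_antisymm (sdim_insert_le s p) ?_
  unfold sdim
  rw [if_pos (insert_nonempty p s)]
  by_cases hn : s.Nonempty
  · rw [if_pos hn]
    have : FiniteDimensional ℝ (affineSpan ℝ (insert p s)).direction := by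
      rw [direction_affineSpan]; exact finiteDimensional_vectorSpan_of_finite ℝ (hs.insert p)
    have hlt : (affineSpan ℝ s).direction < (affineSpan ℝ (insert p s)).direction := by
      apply AffineSubspace.direction_lt_of_nonempty
      · refine lt_of_le_of_ne (affineSpan_mono ℝ (subset_insert p s)) ?_
        intro h
        exact hp (h ▸ subset_affineSpan ℝ _ (mem_insert p s))
      · exact (affineSpan_nonempty ℝ).2 hn
    have := Submodule.finrank_lt_finrank_of_lt hlt
    omega
  · rw [if_neg hn]
    omega

/-- A vertex outside a face is outside its affine hull. -/
theorem notMem_affineSpan_face {ι : Type*} (S : Finset ι) (y : ι → V) (F : Set V)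
    (hE : IsExtreme ℝ (convexHull ℝ (y '' S)) F) (hF : Convex ℝ F) (i : ι) (hi : i ∈ S)
    (hiF : y i ∉ F) : y i ∉ affineSpan ℝ F := by
  obtain ⟨f, c, -, h2, h3⟩ := exists_support S y F hE hF i hi hiF
  intro hmem
  have : ∀ z ∈ affineSpan ℝ F, f z = c := by
    intro z hz
    refine affineSpan_induction hz h2 ?_
    intro a u v w hu hv hw
    simp [hu, hv, hw]
  linarith [this _ hmem]

open Classical in
/-- The face cut out by a supporting functional. -/
theorem exposed_face {ι : Type*} (S : Finset ι) (y : ι → V) (f : V →ₗ[ℝ] ℝ) (c : ℝ)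
    (hf : ∀ k ∈ S, f (y k) ≤ c) :
    IsFaceOf (convexHull ℝ (y '' S))
      (convexHull ℝ (y '' (S.filter (fun k => f (y k) = c) : Finset ι))) ∧
    (∀ z ∈ convexHull ℝ (y '' (S.filter (fun k => f (y k) = c) : Finset ι)), f z = c) := by
  have hQ : ∀ z ∈ convexHull ℝ (y '' S), f z ≤ c := by
    have : convexHull ℝ (y '' S) ⊆ {z | f z ≤ c} := by
      refine convexHull_min ?_ (convex_halfSpace_le f.isLinear c)
      rintro _ ⟨k, hk, rfl⟩
      exact hf k hk
    exact fun z hz => this hz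
  obtain ⟨G, hG⟩ : ∃ G : Set V, G = convexHull ℝ (y '' S) ∩ {z | f z = c} := ⟨_, rfl⟩
  have hGE : IsExtreme ℝ (convexHull ℝ (y '' S)) G := by
    rw [hG]
    refine ⟨inter_subset_left, ?_⟩
    rintro a ha b hb z ⟨hz, hzc⟩ ⟨s, t, hs, ht, hst, rfl⟩
    refine ⟨ha, ?_⟩
    simp only [mem_ofPred_eq, map_add, map_smul, smul_eq_mul] at hzc ⊢
    have h1 := hQ a ha
    have h2 := hQ b hb
    by_contra hne
    have h3 : f a < c := lt_of_le_of_ne h1 hne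
    have h4 : s * f a < s * c := mul_lt_mul_of_pos_left h3 hs
    have h5 : t * f b ≤ t * c := mul_le_mul_of_nonneg_left h2 ht.le
    have h6 : s * c + t * c = c := by rw [← add_mul, hst, one_mul]
    linarith
  have hGc : Convex ℝ G := hG ▸ (convex_convexHull ℝ _).inter (convex_hyperplane f.isLinear c)
  have hGeq := face_eq_hull S y G hGE hGc
  have hfil : S.filter (fun k => y k ∈ G) = S.filter (fun k => f (y k) = c) := by
    refine Finset.filter_congr fun k hk => ?_
    constructor
    · exact fun h => (hG ▸ h).2
    · exact fun h => hG ▸ ⟨subset_convexHull _ _ ⟨k, hk, rfl⟩, h⟩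
  rw [hfil] at hGeq
  rw [← hGeq]
  refine ⟨⟨hGE, hGc, ?_⟩, fun z hz => (hG ▸ hz).2⟩
  rw [hGeq]
  exact ((Finset.finite_toSet _).image y).isClosed_convexHull ℝ

open Classical in
/-- A face is separated from a vertex outside it by a facet. -/
theorem exists_facet {ι : Type*} (S : Finset ι) (y : ι → V) (F : Set V) (d : ℕ)
    (hd : sdim (convexHull ℝ (y '' S)) = d)
    (hE : IsExtreme ℝ (convexHull ℝ (y '' S)) F) (hF : Convex ℝ F) (i : ι) (hi : i ∈ S)
    (hiF : y i ∉ F) :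
    ∃ G : Set V, IsFacetOf d (convexHull ℝ (y '' S)) G ∧ F ⊆ G ∧ y i ∉ G := by
  have hFI := face_eq_hull S y F hE hF
  let P : Finset ι → Prop := fun I => ∃ (f : V →ₗ[ℝ] ℝ) (c : ℝ), (∀ k ∈ S, f (y k) ≤ c) ∧
    (∀ z ∈ F, f z = c) ∧ f (y i) < c ∧ I = S.filter (fun k => f (y k) = c)
  obtain ⟨f0, c0, h01, h02, h03⟩ := exists_support S y F hE hF i hi hiF
  have hne : (S.powerset.filter P).Nonempty := by
    refine ⟨S.filter (fun k => f0 (y k) = c0), ?_⟩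
    rw [Finset.mem_filter, Finset.mem_powerset]
    exact ⟨Finset.filter_subset _ _, f0, c0, h01, h02, h03, rfl⟩
  obtain ⟨I, hI, hmax⟩ := Finset.exists_max_image _ Finset.card hne
  rw [Finset.mem_filter] at hI
  obtain ⟨-, f, c, h1, h2, h3, rfl⟩ := hI
  obtain ⟨hface, hfc⟩ := exposed_face S y f c h1
  set G := convexHull ℝ (y '' (S.filter (fun k => f (y k) = c) : Finset ι)) with hG
  have hiG : y i ∉ G := fun h => by linarith [hfc _ h]
  have hfin : (y '' (S.filter (fun k => f (y k) = c) : Finset ι)).Finite :=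
    (Finset.finite_toSet _).image y
  refine ⟨G, ⟨hface, ?_⟩, ?_, hiG⟩
  · have hnot := notMem_affineSpan_face S y G hface.1 hface.2.1 i hi hiG
    rw [hG, affineSpan_convexHull] at hnot
    have hins := sdim_insert_eq hfin hnot
    have hle : sdim (insert (y i) (y '' (S.filter (fun k => f (y k) = c) : Finset ι))) ≤ d := by
      rw [← hd, sdim_convexHull]
      refine sdim_mono ((Finset.finite_toSet _).image y) ?_
      rintro _ (rfl | ⟨k, hk, rfl⟩)
      · exact ⟨i, hi, rfl⟩
      · exact ⟨k, (Finset.mem_filter.1 hk).1, rfl⟩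
    rw [hG, sdim_convexHull]
    by_contra hcon
    have hlt : sdim (insert (y i) (y '' (S.filter (fun k => f (y k) = c) : Finset ι))) < d := by
      omega
    -- there is a vertex off the span
    have hk : ∃ k ∈ S, y k ∉ affineSpan ℝ
        (insert (y i) (y '' (S.filter (fun k => f (y k) = c) : Finset ι))) := by
      by_contra hall
      push Not at hall
      have hsub : affineSpan ℝ (y '' S) ≤ affineSpan ℝ
        (insert (y i) (y '' (S.filter (fun k => f (y k) = c) : Finset ι))) := by
        rw [affineSpan_le]
        rintro _ ⟨k, hk, rfl⟩
        exact hall k hk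
      have : sdim (y '' S) ≤
          sdim (insert (y i) (y '' (S.filter (fun k => f (y k) = c) : Finset ι))) := by
        unfold sdim
        rw [if_pos ⟨_, i, hi, rfl⟩, if_pos (insert_nonempty _ _)]
        have : FiniteDimensional ℝ (affineSpan ℝ
            (insert (y i) (y '' (S.filter (fun k => f (y k) = c) : Finset ι)))).direction := by
          rw [direction_affineSpan]
          exact finiteDimensional_vectorSpan_of_finite ℝ (hfin.insert _)
        exact_mod_cast Submodule.finrank_mono (AffineSubspace.direction_le hsub)
      rw [sdim_convexHull] at hd
      omega
    obtain ⟨k, hkS, hk⟩ := hk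
    set A := affineSpan ℝ
        (insert (y i) (y '' (S.filter (fun k => f (y k) = c) : Finset ι))) with hA
    have hiA : y i ∈ A := subset_affineSpan ℝ _ (mem_insert _ _)
    have hkd : y k - y i ∉ A.direction := by
      intro h
      apply hk
      have := AffineSubspace.vadd_mem_of_mem_direction h hiA
      simpa using this
    obtain ⟨g, hgk, hgle⟩ := Submodule.exists_le_ker_of_notMem hkd
    have hgA : ∀ z ∈ A, g z = g (y i) := by
      intro z hz
      have h4 : z - y i ∈ A.direction := AffineSubspace.vsub_mem_direction hz hiA
      have := hgle h4
      rw [LinearMap.mem_ker, map_sub] at this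
      linarith
    obtain ⟨g, hgk, hgA⟩ : ∃ g : V →ₗ[ℝ] ℝ, 0 < g (y k) - g (y i) ∧ ∀ z ∈ A, g z = g (y i) := by
      rw [map_sub] at hgk
      rcases lt_or_gt_of_ne hgk with h | h
      · refine ⟨-g, ?_, ?_⟩
        · simp only [LinearMap.neg_apply]; linarith
        · intro z hz; simp [hgA z hz]
      · exact ⟨g, h, hgA⟩
    have hne2 : (S.filter (fun k => 0 < g (y k) - g (y i))).Nonempty :=
      ⟨k, Finset.mem_filter.2 ⟨hkS, hgk⟩⟩
    obtain ⟨l, hl, hmin⟩ := Finset.exists_min_image _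
      (fun k => (c - f (y k)) / (g (y k) - g (y i))) hne2
    rw [Finset.mem_filter] at hl
    set t := (c - f (y l)) / (g (y l) - g (y i)) with ht
    have ht0 : 0 ≤ t := div_nonneg (by linarith [h1 l hl.1]) hl.2.le
    have hzero : ∀ z, z ∈ y '' (S.filter (fun k => f (y k) = c) : Finset ι) → g z = g (y i) :=
      fun z hz => hgA z (subset_affineSpan ℝ _ (mem_insert_of_mem _ hz))
    have hvalid : S.filter (fun k => (f + t • g) (y k) = c + t * g (y i)) ∈
        S.powerset.filter P := by
      rw [Finset.mem_filter, Finset.mem_powerset]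
      refine ⟨Finset.filter_subset _ _, f + t • g, c + t * g (y i), ?_, ?_, ?_, rfl⟩
      · intro j hj
        simp only [LinearMap.add_apply, LinearMap.smul_apply, smul_eq_mul]
        by_cases hgj : 0 < g (y j) - g (y i)
        · have := hmin j (Finset.mem_filter.2 ⟨hj, hgj⟩)
          rw [le_div_iff₀ hgj] at this
          linarith
        · have : t * (g (y j) - g (y i)) ≤ 0 :=
            mul_nonpos_of_nonneg_of_nonpos ht0 (by linarith)
          linarith [h1 j hj]
      · intro z hz
        have hzA : z ∈ A := by
          have : F ⊆ A := by
            rw [hFI]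
            refine convexHull_min ?_ A.convex
            rintro _ ⟨j, hj, rfl⟩
            rw [Finset.mem_coe, Finset.mem_filter] at hj
            apply subset_affineSpan ℝ
            apply mem_insert_of_mem
            exact ⟨j, by simpa using ⟨hj.1, h2 _ hj.2⟩, rfl⟩
          exact this hz
        simp [h2 z hz, hgA z hzA]
      · simpa using h3
    have hcard := hmax _ hvalid
    have hss : S.filter (fun k => f (y k) = c) ⊂
        S.filter (fun k => (f + t • g) (y k) = c + t * g (y i)) := by
      rw [Finset.ssubset_iff_of_subset]
      · refine ⟨l, ?_, ?_⟩
        · rw [Finset.mem_filter]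
          refine ⟨hl.1, ?_⟩
          have : t * (g (y l) - g (y i)) = c - f (y l) := div_mul_cancel₀ _ hl.2.ne'
          simp only [LinearMap.add_apply, LinearMap.smul_apply, smul_eq_mul]
          linarith
        · intro hl'
          have := hzero (y l) ⟨l, hl', rfl⟩
          linarith [hl.2]
      · intro j hj
        have h5 := hzero (y j) ⟨j, hj, rfl⟩
        rw [Finset.mem_filter] at hj ⊢
        refine ⟨hj.1, ?_⟩
        simp [hj.2, h5]
    exact absurd (Finset.card_lt_card hss) (by omega)
  · rw [hFI, hG]
    refine convexHull_mono (image_mono ?_)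
    intro j hj
    rw [Finset.mem_coe, Finset.mem_filter] at hj ⊢
    exact ⟨hj.1, h2 _ hj.2⟩

/-! ### Part 2: combinatorics of the vertex-facet incidences (`d = m + 2`) -/

/-- Vertex `i` lies on `T_p`. -/
def FT (m p i : ℕ) : Prop := p ≤ i ∧ i ≤ p + m + 1

/-- Vertex `i` lies on `E_j`. -/
def FE (m n j i : ℕ) : Prop :=
  i = 0 ∨ (1 ≤ i ∧ j ≤ i + m ∧ i ≤ j + m ∧ (i ≠ j ∨ j = n))

/-- Some facet contains `U` and misses `i`. -/
def SepIx (m n : ℕ) (U : Finset ℕ) (i : ℕ) : Prop :=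
  (∃ p, p + m + 1 ≤ n ∧ (∀ u ∈ U, FT m p u) ∧ ¬ FT m p i) ∨
  (∃ j, 2 ≤ j ∧ j ≤ n ∧ (∀ u ∈ U, FE m n j u) ∧ ¬ FE m n j i)

/-- `U` is an intersection of facets. -/
def ClosedIx (m n : ℕ) (U : Finset ℕ) : Prop :=
  U ⊆ Finset.range (n + 1) ∧ ∀ i ≤ n, i ∉ U → SepIx m n U i

theorem exists_min_max (U : Finset ℕ) (h : U.Nonempty) :
    ∃ a b, a ∈ U ∧ b ∈ U ∧ ∀ u ∈ U, a ≤ u ∧ u ≤ b :=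
  ⟨U.min' h, U.max' h, U.min'_mem h, U.max'_mem h,
    fun u hu => ⟨U.min'_le u hu, U.le_max' u hu⟩⟩

/-- Index sets of faces missing `x_0`. -/
def TypeT (m n : ℕ) (U : Finset ℕ) : Prop :=
  U ⊆ Finset.Icc 1 n ∧ ∀ u ∈ U, ∀ v ∈ U, v ≤ u + m + 1

/-- Links (at `x_0`) of the simplex faces through `x_0`. -/
def TypeS (m n : ℕ) (C : Finset ℕ) : Prop :=
  C ⊆ Finset.Icc 1 n ∧ ((∀ u ∈ C, ∀ v ∈ C, v + 1 ≤ u + m) ∨ C ⊆ Finset.Icc 1 (m + 1) ∨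
    C ⊆ Finset.Icc (n - m) n)

/-- Sets `A` of indices `j` of the facets `E_j` through the larger faces. -/
def TypeB (m n : ℕ) (A : Finset ℕ) : Prop :=
  A ⊆ Finset.Icc 2 (n - 1) ∧ ∀ u ∈ A, ∀ v ∈ A, v + 1 ≤ u + m

/-- The intersection of the `E_a`, `a ∈ A`. -/
def FA (m n : ℕ) (A : Finset ℕ) : Finset ℕ :=
  insert 0 ((Finset.Icc 1 n).filter (fun i => ∀ a ∈ A, i ≠ a ∧ a ≤ i + m ∧ i ≤ a + m))

theorem closed_T {m n : ℕ} (hm : 1 ≤ m) (hn : m + 2 ≤ n) {U : Finset ℕ} (hU : TypeT m n U) :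
    ClosedIx m n U := by
  obtain ⟨hU1, hU2⟩ := hU
  have hU1' : ∀ u ∈ U, 1 ≤ u ∧ u ≤ n := fun u hu => Finset.mem_Icc.1 (hU1 hu)
  refine ⟨fun u hu => Finset.mem_range.2 (by have := hU1' u hu; omega), ?_⟩
  intro i hin hi
  have hiu : ∀ u ∈ U, u ≠ i := fun u hu h => hi (h ▸ hu)
  rcases U.eq_empty_or_nonempty with rfl | hne
  · by_cases h0 : i = 0
    · left; exact ⟨1, by omega, by simp, by unfold FT; omega⟩
    by_cases h1 : i = n
    · left; exact ⟨0, by omega, by simp, by unfold FT; omega⟩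
    by_cases h2 : i = 1
    · right; exact ⟨n, by omega, by omega, by simp, by unfold FE; omega⟩
    · right; exact ⟨i, by omega, by omega, by simp, by unfold FE; omega⟩
  obtain ⟨a, b, ha, hb, hab⟩ := exists_min_max U hne
  have hab2 := hU2 a ha b hb
  have ha1 := hU1' a ha
  have hb1 := hU1' b hb
  have hT : ∀ p, p + m + 1 ≤ n → p ≤ a → b ≤ p + m + 1 → (i < p ∨ p + m + 1 < i) →
      SepIx m n U i := by
    intro p h1 h2 h3 h4
    left
    exact ⟨p, h1, fun u hu => by have := hab u hu; unfold FT; omega, by unfold FT; omega⟩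
  have hE : 2 ≤ i → i < n → i ≤ a + m → b ≤ i + m → SepIx m n U i := by
    intro h1 h2 h3 h4
    right
    exact ⟨i, h1, by omega, fun u hu => by
      have := hab u hu; have := hiu u hu; have := hU1' u hu; unfold FE; omega,
      by unfold FE; omega⟩
  have hEn : n ≤ a + m → i < n - m → 1 ≤ i → SepIx m n U i := by
    intro h1 h2 h3
    right
    exact ⟨n, by omega, le_rfl, fun u hu => by
      have := hab u hu; have := hU1' u hu; unfold FE; omega, by unfold FE; omega⟩
  have hia := hiu a ha
  have hib := hiu b hb
  rcases Nat.lt_or_ge i a with h | h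
  · rcases Nat.le_or_le a (n - m - 1) with h' | h'
    · exact hT a (by omega) le_rfl (by omega) (by omega)
    · rcases Nat.lt_or_ge i (n - m - 1) with h2 | h2
      · exact hT (n - m - 1) (by omega) (by omega) (by omega) (by omega)
      · by_cases h3 : i = n - m - 1
        · exact hEn (by omega) (by omega) (by omega)
        · exact hE (by omega) (by omega) (by omega) (by omega)
  rcases Nat.lt_or_ge b i with h' | h'
  · rcases Nat.lt_or_ge b (m + 1) with h2 | h2
    · by_cases h3 : i ≤ m + 1
      · exact hE (by omega) (by omega) (by omega) (by omega)
      · exact hT 0 (by omega) (by omega) (by omega) (by omega)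
    · exact hT (b - m - 1) (by omega) (by omega) (by omega) (by omega)
  · exact hE (by omega) (by omega) (by omega) (by omega)

theorem closed_S {m n : ℕ} (hm : 1 ≤ m) (hn : m + 2 ≤ n) {C : Finset ℕ} (hC : TypeS m n C) :
    ClosedIx m n (insert 0 C) := by
  obtain ⟨hU1, hU2⟩ := hC
  have hU1' : ∀ u ∈ C, 1 ≤ u ∧ u ≤ n := fun u hu => Finset.mem_Icc.1 (hU1 hu)
  refine ⟨fun u hu => ?_, ?_⟩
  · rcases Finset.mem_insert.1 hu with rfl | hu
    · simp
    · exact Finset.mem_range.2 (by have := hU1' u hu; omega)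
  intro i hin hi
  rw [Finset.mem_insert, not_or] at hi
  obtain ⟨hi0, hi⟩ := hi
  have hiu : ∀ u ∈ C, u ≠ i := fun u hu h => hi (h ▸ hu)
  rcases C.eq_empty_or_nonempty with rfl | hne
  · by_cases h1 : i = n
    · left; exact ⟨0, by omega, by simp [FT], by unfold FT; omega⟩
    by_cases h2 : i = 1
    · right; exact ⟨n, by omega, by omega, by simp [FE], by unfold FE; omega⟩
    · right; exact ⟨i, by omega, by omega, by simp [FE], by unfold FE; omega⟩
  obtain ⟨a, b, ha, hb, hab⟩ := exists_min_max C hne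
  have ha1 := hU1' a ha
  have hb1 := hU1' b hb
  have hia := hiu a ha
  have hib := hiu b hb
  have haleb := (hab a ha).2
  have hcase : b + 1 ≤ a + m ∨ (b = m + 1 ∧ a = 1) ∨ (b = n ∧ a = n - m) := by
    rcases hU2 with h | h | h
    · left; exact h a ha b hb
    · have h1 := Finset.mem_Icc.1 (h ha)
      have h2 := Finset.mem_Icc.1 (h hb)
      omega
    · have h1 := Finset.mem_Icc.1 (h ha)
      have h2 := Finset.mem_Icc.1 (h hb)
      omega
  have hT : b ≤ m + 1 → m + 1 < i → SepIx m n (insert 0 C) i := by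
    intro h1 h2
    left
    refine ⟨0, by omega, ?_, by unfold FT; omega⟩
    intro u hu
    rcases Finset.mem_insert.1 hu with rfl | hu
    · unfold FT; omega
    · have := hab u hu; unfold FT; omega
  have hE : ∀ j, j ∉ C ∨ j = n → 2 ≤ j → j ≤ n → j ≤ a + m → b ≤ j + m →
      (i + m < j ∨ j + m < i ∨ (i = j ∧ j ≠ n)) → SepIx m n (insert 0 C) i := by
    intro j h0 h1 h2 h3 h4 h5
    right
    refine ⟨j, h1, by omega, ?_, by unfold FE; omega⟩
    intro u hu
    rcases Finset.mem_insert.1 hu with rfl | hu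
    · left; rfl
    · have := hab u hu
      have := hU1' u hu
      have : u ≠ j ∨ j = n := by
        rcases h0 with h0 | h0
        · left; intro h; exact h0 (h ▸ hu)
        · right; exact h0
      unfold FE; omega
  rcases Nat.lt_or_ge i a with h | h
  · rcases Nat.lt_or_ge (a + m) n with h' | h'
    · refine hE (a + m) (Or.inl ?_) (by omega) (by omega) (by omega) (by omega) (by omega)
      intro hmem
      have := hab _ hmem
      omega
    · rcases Nat.lt_or_ge i (n - m) with h2 | h2
      · exact hE n (Or.inr rfl) (by omega) (by omega) (by omega) (by omega) (by omega)
      · exact hE i (Or.inl hi) (by omega) (by omega) (by omega) (by omega) (by omega)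
  rcases Nat.lt_or_ge b i with h' | h'
  · rcases Nat.lt_or_ge b (m + 2) with h2 | h2
    · rcases Nat.lt_or_ge (m + 1) i with h3 | h3
      · exact hT (by omega) h3
      · exact hE i (Or.inl hi) (by omega) (by omega) (by omega) (by omega) (by omega)
    · refine hE (b - m) (Or.inl ?_) (by omega) (by omega) (by omega) (by omega) (by omega)
      intro hmem
      have := hab _ hmem
      omega
  · exact hE i (Or.inl hi) (by omega) (by omega) (by omega) (by omega) (by omega)

theorem closed_B {m n : ℕ} (hn : m + 2 ≤ n) {A : Finset ℕ} (hA : A ⊆ Finset.Icc 2 (n - 1)) :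
    ClosedIx m n (FA m n A) := by
  refine ⟨fun u hu => ?_, ?_⟩
  · unfold FA at hu
    rw [Finset.mem_insert, Finset.mem_filter, Finset.mem_Icc] at hu
    rw [Finset.mem_range]; omega
  intro i hin hi
  have hi' := hi
  unfold FA at hi
  rw [Finset.mem_insert, Finset.mem_filter, Finset.mem_Icc, not_or, not_and] at hi
  obtain ⟨h0, h1⟩ := hi
  have h2 := h1 ⟨by omega, hin⟩
  push Not at h2
  obtain ⟨a, ha, h3⟩ := h2
  have ha2 := Finset.mem_Icc.1 (hA ha)
  right
  refine ⟨a, ha2.1, by omega, ?_, ?_⟩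
  · intro u hu
    unfold FA at hu
    rw [Finset.mem_insert, Finset.mem_filter, Finset.mem_Icc] at hu
    rcases hu with rfl | ⟨hu1, hu2⟩
    · left; rfl
    · have := hu2 a ha
      unfold FE; omega
  · by_cases h : i = a
    · unfold FE; omega
    · by_cases h' : a ≤ i + m
      · have := h3 h h'
        unfold FE; omega
      · unfold FE; omega

/-- A window of `d` consecutive vertices around a set of type `B`. -/
theorem exists_window {m n : ℕ} (hn : m + 2 ≤ n) {A : Finset ℕ} (hA : TypeB m n A) :
    ∃ p, 1 ≤ p ∧ p + m + 1 ≤ n ∧ A ⊆ Finset.Icc (p + 1) (p + m) ∧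
      ∀ a ∈ A, ∀ i ∈ Finset.Icc p (p + m + 1), a ≤ i + m ∧ i ≤ a + m := by
  obtain ⟨h1, h2⟩ := hA
  rcases A.eq_empty_or_nonempty with rfl | hne
  · exact ⟨1, le_rfl, by omega, by simp, by simp⟩
  obtain ⟨a, b, ha, hb, hab⟩ := exists_min_max A hne
  have ha1 := Finset.mem_Icc.1 (h1 ha)
  have hb1 := Finset.mem_Icc.1 (h1 hb)
  have hs := h2 a ha b hb
  refine ⟨max 1 (b - m), by omega, by omega, ?_, ?_⟩
  · intro u hu
    have := hab u hu
    rw [Finset.mem_Icc]; omega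
  · intro u hu i hi
    have := hab u hu
    rw [Finset.mem_Icc] at hi; omega

theorem classify {m n : ℕ} (hm : 1 ≤ m) (hn : m + 2 ≤ n) {U : Finset ℕ} (hU : ClosedIx m n U) :
    TypeT m n U ∨ (∃ C, TypeS m n C ∧ U = insert 0 C) ∨ (∃ A, TypeB m n A ∧ U = FA m n A) := by
  classical
  obtain ⟨hU1, hU2⟩ := hU
  have hU1' : ∀ u ∈ U, u ≤ n := fun u hu => by
    have := Finset.mem_range.1 (hU1 hu); omega
  by_cases h0 : 0 ∈ U
  swap
  · left
    have hpos : ∀ u ∈ U, 1 ≤ u := fun u hu => by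
      rcases Nat.eq_zero_or_pos u with rfl | h
      · exact absurd hu h0
      · exact h
    refine ⟨fun u hu => Finset.mem_Icc.2 ⟨hpos u hu, hU1' u hu⟩, ?_⟩
    rcases hU2 0 (by omega) h0 with ⟨p, hp, hp2, hp3⟩ | ⟨j, _, _, _, hj⟩
    · intro u hu v hv
      have h1 := hp2 u hu
      have h2 := hp2 v hv
      unfold FT at h1 h2
      omega
    · exact absurd (Or.inl rfl) hj
  right
  set C := U.erase 0 with hC
  have hUC : U = insert 0 C := (Finset.insert_erase h0).symm
  have hCU : ∀ u ∈ C, u ∈ U ∧ 1 ≤ u ∧ u ≤ n := fun u hu => by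
    have h1 := Finset.mem_erase.1 hu
    exact ⟨h1.2, by omega, hU1' u h1.2⟩
  have hCsub : C ⊆ Finset.Icc 1 n := fun u hu => Finset.mem_Icc.2 (hCU u hu).2
  rcases C.eq_empty_or_nonempty with hC0 | hne
  · left
    refine ⟨C, ⟨hCsub, Or.inl ?_⟩, hUC⟩
    rw [hC0]; simp
  obtain ⟨a, b, ha, hb, hab⟩ := exists_min_max C hne
  have haU := hCU a ha
  have hbU := hCU b hb
  have haleb := (hab a ha).2
  rcases Nat.lt_or_ge b (a + m) with hlt | hge
  · left
    refine ⟨C, ⟨hCsub, Or.inl ?_⟩, hUC⟩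
    intro u hu v hv
    have := hab u hu
    have := hab v hv
    omega
  by_cases heq : b = a + m
  · left
    refine ⟨C, ⟨hCsub, Or.inr ?_⟩, hUC⟩
    by_cases ha1 : a = 1
    · left
      intro u hu
      have := hab u hu
      rw [Finset.mem_Icc]; omega
    by_cases hb1 : b = n
    · right
      intro u hu
      have := hab u hu
      rw [Finset.mem_Icc]; omega
    exfalso
    have hb2 : b + 1 ∉ U := by
      intro h
      have : b + 1 ∈ C := Finset.mem_erase.2 ⟨by omega, h⟩
      have := hab _ this
      omega
    rcases hU2 (b + 1) (by omega) hb2 with ⟨p, hp, hp2, hp3⟩ | ⟨j, hj1, hj2, hj3, hj4⟩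
    · have h1 := hp2 0 h0
      have h2 := hp2 b hbU.1
      unfold FT at h1 h2
      omega
    · have h1 := hj3 a haU.1
      have h2 := hj3 b hbU.1
      unfold FE at h1 h2 hj4
      omega
  · right
    refine ⟨(Finset.Icc 2 (n - 1)).filter (fun j => ∀ u ∈ U, FE m n j u),
      ⟨Finset.filter_subset _ _, ?_⟩, ?_⟩
    · intro u hu v hv
      rw [Finset.mem_filter] at hu hv
      have h1 := hu.2 a haU.1
      have h2 := hu.2 b hbU.1
      have h3 := hv.2 a haU.1
      have h4 := hv.2 b hbU.1
      unfold FE at h1 h2 h3 h4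
      omega
    · ext i
      unfold FA
      rw [Finset.mem_insert, Finset.mem_filter, Finset.mem_Icc]
      constructor
      · intro hi
        by_cases hi0 : i = 0
        · left; exact hi0
        right
        refine ⟨⟨by omega, hU1' i hi⟩, ?_⟩
        intro j hj
        rw [Finset.mem_filter, Finset.mem_Icc] at hj
        have h1 := hj.2 i hi
        unfold FE at h1
        omega
      · rintro (rfl | ⟨hi1, hi2⟩)
        · exact h0
        by_contra hiU
        rcases hU2 i hi1.2 hiU with ⟨p, hp, hp2, hp3⟩ | ⟨j, hj1, hj2, hj3, hj4⟩
        · have h1 := hp2 0 h0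
          have h2 := hp2 b hbU.1
          unfold FT at h1 h2
          omega
        · have h1 := hj3 a haU.1
          have h2 := hj3 b hbU.1
          have hjn : j ≠ n := by
            unfold FE at h1 h2; omega
          have h3 := hi2 j (Finset.mem_filter.2 ⟨Finset.mem_Icc.2 ⟨hj1, by omega⟩, hj3⟩)
          apply hj4
          unfold FE; omega

theorem FA_inj {m n : ℕ} (hn : m + 2 ≤ n) {A B : Finset ℕ} (hA : TypeB m n A)
    (hB : TypeB m n B) (h : FA m n A = FA m n B) : A ⊆ B := by
  intro a ha
  by_contra haB
  obtain ⟨p, hp1, hp2, hp3, hp4⟩ := exists_window hn hA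
  have ha1 := Finset.mem_Icc.1 (hA.1 ha)
  have hap := Finset.mem_Icc.1 (hp3 ha)
  have hin : ∀ i ∈ Finset.Icc p (p + m + 1), i ∉ A → i ∈ FA m n B := by
    intro i hi hiA
    rw [← h]
    unfold FA
    rw [Finset.mem_insert, Finset.mem_filter, Finset.mem_Icc]
    right
    have hi' := Finset.mem_Icc.1 hi
    exact ⟨by omega, fun c hc => ⟨fun e => hiA (e ▸ hc), hp4 c hc i hi⟩⟩
  have h1 : p ∈ FA m n B := by
    refine hin p (by rw [Finset.mem_Icc]; omega) fun hc => ?_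
    have := Finset.mem_Icc.1 (hp3 hc); omega
  have h2 : p + m + 1 ∈ FA m n B := by
    refine hin _ (by rw [Finset.mem_Icc]; omega) fun hc => ?_
    have := Finset.mem_Icc.1 (hp3 hc); omega
  have h3 : a ∉ FA m n B := by
    rw [← h]
    unfold FA
    rw [Finset.mem_insert, Finset.mem_filter, not_or]
    exact ⟨by omega, fun hc => (hc.2 a ha).1 rfl⟩
  apply h3
  unfold FA at h1 h2 ⊢
  rw [Finset.mem_insert, Finset.mem_filter, Finset.mem_Icc] at h1 h2 ⊢
  right
  refine ⟨by omega, fun c hc => ⟨fun e => haB (e ▸ hc), ?_⟩⟩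
  rcases h1 with h1 | h1
  · omega
  rcases h2 with h2 | h2
  · omega
  have := h1.2 c hc
  have := h2.2 c hc
  omega

theorem FA_not_S {m n : ℕ} (hn : m + 2 ≤ n) {A C : Finset ℕ} (hA : TypeB m n A)
    (hC : TypeS m n C) : FA m n A ≠ insert 0 C := by
  intro h
  obtain ⟨p, hp1, hp2, hp3, hp4⟩ := exists_window hn hA
  have hin : ∀ i ∈ Finset.Icc p (p + m + 1), i ∉ A → i ∈ C := by
    intro i hi hiA
    have hi' := Finset.mem_Icc.1 hi
    have : i ∈ insert 0 C := by
      rw [← h]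
      unfold FA
      rw [Finset.mem_insert, Finset.mem_filter, Finset.mem_Icc]
      right
      exact ⟨by omega, fun c hc => ⟨fun e => hiA (e ▸ hc), hp4 c hc i hi⟩⟩
    rcases Finset.mem_insert.1 this with h1 | h1
    · omega
    · exact h1
  have h1 : p ∈ C := by
    refine hin p (by rw [Finset.mem_Icc]; omega) fun hc => ?_
    have := Finset.mem_Icc.1 (hp3 hc); omega
  have h2 : p + m + 1 ∈ C := by
    refine hin _ (by rw [Finset.mem_Icc]; omega) fun hc => ?_
    have := Finset.mem_Icc.1 (hp3 hc); omega
  rcases hC.2 with h3 | h3 | h3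
  · have := h3 _ h1 _ h2; omega
  · have := Finset.mem_Icc.1 (h3 h1); have := Finset.mem_Icc.1 (h3 h2); omega
  · have := Finset.mem_Icc.1 (h3 h1); have := Finset.mem_Icc.1 (h3 h2); omega

/-! ### Part 3: counting -/

/-- `choose (w - 1) (k - 1)`, being `0` for `k = 0`. -/
def chp (w : ℕ) : ℕ → ℕ
  | 0 => 0
  | k + 1 => w.choose k

/-- `k`-subsets of an interval of length `L` contained in a window of length `w`. -/
def spanSets (lo L w k : ℕ) : Finset (Finset ℕ) :=
  ((Finset.Ico lo (lo + L)).powersetCard k).filter (fun U => ∀ u ∈ U, ∀ v ∈ U, v + 1 ≤ u + w)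

theorem card_spanSets (lo w k : ℕ) (t : ℕ) :
    (spanSets lo (w + 1 + t) (w + 1) k).card = (w + 1).choose k + t * chp w k := by
  classical
  rcases k with _ | k
  · have : spanSets lo (w + 1 + t) (w + 1) 0 = {∅} := by
      unfold spanSets
      rw [Finset.powersetCard_zero]
      rw [Finset.filter_singleton]
      simp
    rw [this]; simp [chp]
  induction t with
  | zero =>
    have : spanSets lo (w + 1 + 0) (w + 1) (k + 1) =
        (Finset.Ico lo (lo + (w + 1))).powersetCard (k + 1) := by
      unfold spanSets
      refine Finset.filter_true_of_mem ?_
      intro U hU u hu v hv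
      have h1 := (Finset.mem_powersetCard.1 hU).1
      have h2 := Finset.mem_Ico.1 (h1 hu)
      have h3 := Finset.mem_Ico.1 (h1 hv)
      omega
    rw [this, Finset.card_powersetCard]
    simp
  | succ t ih =>
    have hun : spanSets lo (w + 1 + (t + 1)) (w + 1) (k + 1) =
        spanSets lo (w + 1 + t) (w + 1) (k + 1) ∪
        ((Finset.Ico (lo + t + 1) (lo + w + 1 + t)).powersetCard k).image
          (insert (lo + w + 1 + t)) := by
      ext U
      simp only [spanSets, Finset.mem_union, Finset.mem_filter, Finset.mem_powersetCard,
        Finset.mem_image]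
      constructor
      · rintro ⟨⟨h1, h2⟩, h3⟩
        by_cases hmem : lo + w + 1 + t ∈ U
        · right
          refine ⟨U.erase (lo + w + 1 + t), ⟨?_, ?_⟩, Finset.insert_erase hmem⟩
          · intro u hu
            have hu' := Finset.mem_erase.1 hu
            have h4 := Finset.mem_Ico.1 (h1 hu'.2)
            have h5 := h3 u hu'.2 _ hmem
            rw [Finset.mem_Ico]; omega
          · rw [Finset.card_erase_of_mem hmem]; omega
        · left
          refine ⟨⟨?_, h2⟩, h3⟩
          intro u hu
          have h4 := Finset.mem_Ico.1 (h1 hu)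
          have : u ≠ lo + w + 1 + t := fun h => hmem (h ▸ hu)
          rw [Finset.mem_Ico]; omega
      · rintro (⟨⟨h1, h2⟩, h3⟩ | ⟨W, ⟨h1, h2⟩, rfl⟩)
        · refine ⟨⟨?_, h2⟩, h3⟩
          intro u hu
          have h4 := Finset.mem_Ico.1 (h1 hu)
          rw [Finset.mem_Ico]; omega
        · have hW : ∀ u ∈ insert (lo + w + 1 + t) W, lo + t + 1 ≤ u ∧ u ≤ lo + w + 1 + t := by
            intro u hu
            rcases Finset.mem_insert.1 hu with rfl | hu
            · omega
            · have h4 := Finset.mem_Ico.1 (h1 hu); omega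
          refine ⟨⟨?_, ?_⟩, ?_⟩
          · intro u hu
            have := hW u hu
            rw [Finset.mem_Ico]; omega
          · rw [Finset.card_insert_of_notMem, h2]
            intro h
            have := Finset.mem_Ico.1 (h1 h); omega
          · intro u hu v hv
            have := hW u hu
            have := hW v hv
            omega
    rw [hun, Finset.card_union_of_disjoint, ih, Finset.card_image_of_injOn,
      Finset.card_powersetCard, Nat.card_Ico]
    · have : lo + w + 1 + t - (lo + t + 1) = w := by omega
      rw [this]; simp only [chp]; ring
    · intro A hA B hB h
      have hA' := (Finset.mem_powersetCard.1 hA).1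
      have hB' := (Finset.mem_powersetCard.1 hB).1
      have h1 : lo + w + 1 + t ∉ A := fun h => by
        have := Finset.mem_Ico.1 (hA' h); omega
      have h2 : lo + w + 1 + t ∉ B := fun h => by
        have := Finset.mem_Ico.1 (hB' h); omega
      rw [← Finset.erase_insert h1, ← Finset.erase_insert h2]
      rw [h]
    · rw [Finset.disjoint_left]
      intro U hU hU2
      obtain ⟨W, -, rfl⟩ := Finset.mem_image.1 hU2
      unfold spanSets at hU
      have h1 := (Finset.mem_powersetCard.1 (Finset.mem_filter.1 hU).1).1
      have := Finset.mem_Ico.1 (h1 (Finset.mem_insert_self _ _))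
      omega

/-- `k`-subsets of `[a, b]` containing both end points. -/
def endSets (a b k : ℕ) : Finset (Finset ℕ) :=
  ((Finset.Icc a b).powersetCard k).filter (fun U => a ∈ U ∧ b ∈ U)

theorem card_endSets (a c k : ℕ) :
    (endSets a (a + c + 1) k).card = (match k with | 0 => 0 | 1 => 0 | k + 2 => c.choose k) := by
  classical
  rcases k with _ | _ | k
  · unfold endSets
    simp
  · rw [Finset.card_eq_zero]
    unfold endSets
    rw [Finset.filter_eq_empty_iff]
    rintro U hU ⟨h1, h2⟩
    have := (Finset.mem_powersetCard.1 hU).2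
    have := Finset.card_le_one.1 this.le _ h1 _ h2
    omega
  · have : endSets a (a + c + 1) (k + 2) = ((Finset.Ioo a (a + c + 1)).powersetCard k).image
        (fun W => insert a (insert (a + c + 1) W)) := by
      ext U
      simp only [endSets, Finset.mem_filter, Finset.mem_powersetCard, Finset.mem_image]
      constructor
      · rintro ⟨⟨h1, h2⟩, h3, h4⟩
        have h5 : a + c + 1 ∈ U.erase a := Finset.mem_erase.2 ⟨by omega, h4⟩
        refine ⟨(U.erase a).erase (a + c + 1), ⟨?_, ?_⟩, ?_⟩
        · intro u hu
          simp only [Finset.mem_erase] at hu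
          have := Finset.mem_Icc.1 (h1 hu.2.2)
          rw [Finset.mem_Ioo]; omega
        · rw [Finset.card_erase_of_mem h5, Finset.card_erase_of_mem h3]; omega
        · rw [Finset.insert_erase h5, Finset.insert_erase h3]
      · rintro ⟨W, ⟨h1, h2⟩, rfl⟩
        have hb : a + c + 1 ∉ W := fun h => by have := Finset.mem_Ioo.1 (h1 h); omega
        have ha : a ∉ insert (a + c + 1) W := fun h => by
          rcases Finset.mem_insert.1 h with h | h
          · omega
          · have := Finset.mem_Ioo.1 (h1 h); omega
        refine ⟨⟨?_, ?_⟩, by simp, by simp⟩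
        · intro u hu
          rw [Finset.mem_insert, Finset.mem_insert] at hu
          rw [Finset.mem_Icc]
          rcases hu with rfl | rfl | hu
          · omega
          · omega
          · have := Finset.mem_Ioo.1 (h1 hu); omega
        · rw [Finset.card_insert_of_notMem ha, Finset.card_insert_of_notMem hb, h2]
    rw [this, Finset.card_image_of_injOn, Finset.card_powersetCard, Nat.card_Ioo]
    · simp only
      congr 1; omega
    · intro A hA B hB h
      have key : ∀ W ∈ (Finset.Ioo a (a + c + 1)).powersetCard k,
          ((insert a (insert (a + c + 1) W)).erase a).erase (a + c + 1) = W := by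
        intro W hW
        have h1 := (Finset.mem_powersetCard.1 hW).1
        have hb : a + c + 1 ∉ W := fun h => by have := Finset.mem_Ioo.1 (h1 h); omega
        have ha : a ∉ insert (a + c + 1) W := fun h => by
          rcases Finset.mem_insert.1 h with h | h
          · omega
          · have := Finset.mem_Ioo.1 (h1 h); omega
        rw [Finset.erase_insert ha, Finset.erase_insert hb]
      rw [← key A hA, ← key B hB]
      simp only at h
      rw [h]

open Classical in
def setsT (m n k : ℕ) : Finset (Finset ℕ) := ((Finset.Icc 1 n).powersetCard k).filter (TypeT m n)

open Classical in
def setsS (m n k : ℕ) : Finset (Finset ℕ) := ((Finset.Icc 1 n).powersetCard k).filter (TypeS m n)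

open Classical in
def setsB (m n k : ℕ) : Finset (Finset ℕ) :=
  ((Finset.Icc 2 (n - 1)).powersetCard k).filter (TypeB m n)

theorem mem_setsT {m n k : ℕ} {U : Finset ℕ} : U ∈ setsT m n k ↔ TypeT m n U ∧ U.card = k := by
  classical
  unfold setsT
  rw [Finset.mem_filter, Finset.mem_powersetCard]
  exact ⟨fun h => ⟨h.2, h.1.2⟩, fun h => ⟨⟨h.1.1, h.2⟩, h.1⟩⟩

theorem mem_setsS {m n k : ℕ} {U : Finset ℕ} : U ∈ setsS m n k ↔ TypeS m n U ∧ U.card = k := by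
  classical
  unfold setsS
  rw [Finset.mem_filter, Finset.mem_powersetCard]
  exact ⟨fun h => ⟨h.2, h.1.2⟩, fun h => ⟨⟨h.1.1, h.2⟩, h.1⟩⟩

theorem mem_setsB {m n k : ℕ} {U : Finset ℕ} : U ∈ setsB m n k ↔ TypeB m n U ∧ U.card = k := by
  classical
  unfold setsB
  rw [Finset.mem_filter, Finset.mem_powersetCard]
  exact ⟨fun h => ⟨h.2, h.1.2⟩, fun h => ⟨⟨h.1.1, h.2⟩, h.1⟩⟩

theorem card_setsT (l t k : ℕ) :
    (setsT (l + 1) (l + 3 + t) k).card = (l + 3).choose k + t * chp (l + 2) k := by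
  rw [← card_spanSets 1 (l + 2) k t]
  congr 1
  ext U
  rw [mem_setsT]
  simp only [spanSets, Finset.mem_filter, Finset.mem_powersetCard, TypeT]
  have : Finset.Ico 1 (1 + (l + 2 + 1 + t)) = Finset.Icc 1 (l + 3 + t) := by
    ext; rw [Finset.mem_Ico, Finset.mem_Icc]; omega
  rw [this]
  constructor
  · rintro ⟨⟨h1, h2⟩, h3⟩
    exact ⟨⟨h1, h3⟩, fun u hu v hv => by have := h2 u hu v hv; omega⟩
  · rintro ⟨⟨h1, h3⟩, h2⟩
    exact ⟨⟨h1, fun u hu v hv => by have := h2 u hu v hv; omega⟩, h3⟩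

theorem card_setsB (l t k : ℕ) :
    (setsB (l + 1) (l + 3 + t) k).card = (l + 1).choose k + t * chp l k := by
  rw [← card_spanSets 2 l k t]
  congr 1
  ext U
  rw [mem_setsB]
  simp only [spanSets, Finset.mem_filter, Finset.mem_powersetCard, TypeB]
  have : Finset.Ico 2 (2 + (l + 1 + t)) = Finset.Icc 2 (l + 3 + t - 1) := by
    ext; rw [Finset.mem_Ico, Finset.mem_Icc]; omega
  rw [this]
  tauto

theorem card_setsS (l t k : ℕ) :
    (setsS (l + 1) (l + 3 + t) k).card = (l + 1).choose k + (t + 2) * chp l k +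
      2 * (match k with | 0 => 0 | 1 => 0 | k + 2 => l.choose k) := by
  classical
  have hun : setsS (l + 1) (l + 3 + t) k = (spanSets 1 (l + 1 + (t + 2)) (l + 1) k ∪
      endSets 1 (1 + l + 1) k) ∪ endSets (t + 2) (t + 2 + l + 1) k := by
    ext U
    rw [mem_setsS]
    simp only [spanSets, endSets, Finset.mem_union, Finset.mem_filter, Finset.mem_powersetCard,
      TypeS]
    have : Finset.Ico 1 (1 + (l + 1 + (t + 2))) = Finset.Icc 1 (l + 3 + t) := by
      ext; rw [Finset.mem_Ico, Finset.mem_Icc]; omega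
    rw [this]
    constructor
    · rintro ⟨⟨h1, h2⟩, h3⟩
      by_cases hs : ∀ u ∈ U, ∀ v ∈ U, v + 1 ≤ u + (l + 1)
      · exact Or.inl (Or.inl ⟨⟨h1, h3⟩, hs⟩)
      rcases h2 with h2 | h2 | h2
      · exact absurd h2 hs
      · left; right
        push Not at hs
        obtain ⟨u, hu, v, hv, huv⟩ := hs
        have hu' := Finset.mem_Icc.1 (h2 hu)
        have hv' := Finset.mem_Icc.1 (h2 hv)
        have e1 : u = 1 := by omega
        have e2 : v = 1 + l + 1 := by omega
        subst e1 e2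
        refine ⟨⟨?_, h3⟩, hu, hv⟩
        intro w hw
        have := Finset.mem_Icc.1 (h2 hw)
        rw [Finset.mem_Icc]; omega
      · right
        push Not at hs
        obtain ⟨u, hu, v, hv, huv⟩ := hs
        have hu' := Finset.mem_Icc.1 (h2 hu)
        have hv' := Finset.mem_Icc.1 (h2 hv)
        have e1 : u = t + 2 := by omega
        have e2 : v = t + 2 + l + 1 := by omega
        subst e1 e2
        refine ⟨⟨?_, h3⟩, hu, hv⟩
        intro w hw
        have := Finset.mem_Icc.1 (h2 hw)
        rw [Finset.mem_Icc]; omega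
    · rintro ((⟨⟨h1, h3⟩, h2⟩ | ⟨⟨h1, h3⟩, h2⟩) | ⟨⟨h1, h3⟩, h2⟩)
      · exact ⟨⟨h1, Or.inl h2⟩, h3⟩
      · refine ⟨⟨?_, Or.inr (Or.inl ?_)⟩, h3⟩ <;>
        · intro w hw
          have := Finset.mem_Icc.1 (h1 hw)
          rw [Finset.mem_Icc]; omega
      · refine ⟨⟨?_, Or.inr (Or.inr ?_)⟩, h3⟩ <;>
        · intro w hw
          have := Finset.mem_Icc.1 (h1 hw)
          rw [Finset.mem_Icc]; omega
  rw [hun, Finset.card_union_of_disjoint, Finset.card_union_of_disjoint, card_spanSets,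
    card_endSets, card_endSets]
  · ring
  · rw [Finset.disjoint_left]
    intro U h1 h2
    simp only [spanSets, endSets, Finset.mem_filter, Finset.mem_powersetCard] at h1 h2
    have := h1.2 _ h2.2.1 _ h2.2.2
    omega
  · rw [Finset.disjoint_left]
    intro U h1 h2
    simp only [spanSets, endSets, Finset.mem_filter, Finset.mem_powersetCard,
      Finset.mem_union] at h1 h2
    rcases h1 with h1 | h1
    · have := h1.2 _ h2.2.1 _ h2.2.2
      omega
    · have := Finset.mem_Icc.1 (h1.1.1 h2.2.2)
      omega

theorem count_total (l t J : ℕ) (hJ : J ≤ l + 4) :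
    (setsT (l + 1) (l + 3 + t) J).card +
      (match J with | 0 => 0 | J + 1 => (setsS (l + 1) (l + 3 + t) J).card) +
      (setsB (l + 1) (l + 3 + t) (l + 4 - J)).card =
    (l + 4).choose J + t * (chp (l + 2) J +
      (match J with | 0 => 0 | J + 1 => chp (l + 1) J)) := by
  rcases J with _ | _ | _ | i
  · simp only [card_setsT, card_setsB]
    have h1 : (l + 1).choose (l + 4) = 0 := Nat.choose_eq_zero_of_lt (by omega)
    have h2 : l.choose (l + 3) = 0 := Nat.choose_eq_zero_of_lt (by omega)
    simp [chp, h1, h2]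
  · simp only [card_setsT, card_setsB, card_setsS]
    have h1 : (l + 1).choose (l + 3) = 0 := Nat.choose_eq_zero_of_lt (by omega)
    have h2 : l.choose (l + 2) = 0 := Nat.choose_eq_zero_of_lt (by omega)
    simp [chp, h1, h2]
    ring
  · simp only [card_setsT, card_setsB, card_setsS]
    have h1 : (l + 1).choose (l + 2) = 0 := Nat.choose_eq_zero_of_lt (by omega)
    have h2 : l.choose (l + 1) = 0 := Nat.choose_eq_zero_of_lt (by omega)
    have h3 : (l + 4).choose 2 = (l + 3).choose 1 + (l + 3).choose 2 := rfl
    simp [chp, h1, h2]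
    rw [h3]
    simp
    ring
  · simp only [card_setsT, card_setsB, card_setsS]
    have e : l + 4 - (i + 1 + 1 + 1) = l + 1 - i := by omega
    rw [e]
    have h1 : (l + 1).choose (l + 1 - i) = (l + 1).choose i := Nat.choose_symm (by omega)
    have h2 : chp l (l + 1 - i) = l.choose i := by
      by_cases hi : i = l + 1
      · subst hi; simp [chp]
      · have : l + 1 - i = (l - i) + 1 := by omega
        rw [this]
        simp only [chp]
        exact Nat.choose_symm (by omega)
    rw [h1, h2]
    simp only [chp]
    have p1 : ∀ a b : ℕ, (a + 1).choose (b + 1) = a.choose b + a.choose (b + 1) :=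
      fun a b => Nat.choose_succ_succ' a b
    have q1 := p1 (l + 3) (i + 2)
    have q2 := p1 (l + 2) (i + 1)
    have q3 := p1 (l + 1) i
    have q4 := p1 (l + 1) (i + 1)
    have q5 := p1 l i
    have q6 := p1 l (i + 1)
    simp only [add_assoc, Nat.reduceAdd] at *
    rw [q1, q2, q3, q4, q5]
    ring

/-! ### Part 4: bridge between geometry and combinatorics -/

/-- The polytope on the vertices `y 0, …, y n`. -/
def PQ (n : ℕ) (y : ℕ → V) : Set V := convexHull ℝ (y '' (Finset.range (n + 1) : Finset ℕ))

/-- Combinatorial repackaging of the braxtope hypotheses. -/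
structure BraxIx (m n : ℕ) (y : ℕ → V) : Prop where
  ext : ∀ i ≤ n, y i ∈ Set.extremePoints ℝ (PQ n y)
  inj : ∀ i ≤ n, ∀ j ≤ n, y i = y j → i = j
  dim : sdim (PQ n y) = ((m + 2 : ℕ) : ℤ)
  facet : ∀ F : Set V, IsFacetOf (m + 2) (PQ n y) F ↔
    (∃ p, p + m + 1 ≤ n ∧ F = convexHull ℝ (y '' {i | i ≤ n ∧ FT m p i})) ∨
    (∃ j, 2 ≤ j ∧ j ≤ n ∧ F = convexHull ℝ (y '' {i | i ≤ n ∧ FE m n j i}))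

theorem BraxIx.mem_hull {m n : ℕ} {y : ℕ → V} (h : BraxIx m n y) {U : Set ℕ}
    (hU : ∀ u ∈ U, u ≤ n) {i : ℕ} (hi : i ≤ n) (hm : y i ∈ convexHull ℝ (y '' U)) : i ∈ U := by
  have hsub : convexHull ℝ (y '' U) ⊆ PQ n y := by
    refine convexHull_mono (Set.image_mono ?_)
    intro u hu
    have := hU u hu
    simp; omega
  have h1 := inter_extremePoints_subset_extremePoints_of_subset hsub ⟨hm, h.ext i hi⟩
  obtain ⟨u, hu, hui⟩ := extremePoints_convexHull_subset h1
  have := h.inj u (hU u hu) i hi hui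
  exact this ▸ hu

theorem BraxIx.closed_of_face {m n : ℕ} {y : ℕ → V} (h : BraxIx m n y) {F : Set V}
    (hF : IsFaceOf (PQ n y) F) :
    ∃ U : Finset ℕ, ClosedIx m n U ∧ F = convexHull ℝ (y '' U) := by
  classical
  obtain ⟨hE, hC, -⟩ := hF
  have hfe := face_eq_hull (Finset.range (n + 1)) y F hE hC
  refine ⟨_, ⟨Finset.filter_subset _ _, ?_⟩, hfe⟩
  intro i hi hiU
  have hiF : y i ∉ F := fun hm => hiU (by simp [hm]; omega)
  obtain ⟨G, hG, hFG, hiG⟩ := exists_facet (Finset.range (n + 1)) y F (m + 2) h.dim hE hC i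
    (by simp; omega) hiF
  rcases (h.facet G).1 hG with ⟨p, hp, rfl⟩ | ⟨j, hj1, hj2, rfl⟩
  · left
    refine ⟨p, hp, ?_, ?_⟩
    · intro u hu
      have hu' := Finset.mem_filter.1 hu
      exact (h.mem_hull (fun u hu => hu.1) (by have := Finset.mem_range.1 hu'.1; omega)
        (hFG hu'.2)).2
    · intro hFT
      exact hiG (subset_convexHull ℝ _ ⟨i, ⟨hi, hFT⟩, rfl⟩)
  · right
    refine ⟨j, hj1, hj2, ?_, ?_⟩
    · intro u hu
      have hu' := Finset.mem_filter.1 hu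
      exact (h.mem_hull (fun u hu => hu.1) (by have := Finset.mem_range.1 hu'.1; omega)
        (hFG hu'.2)).2
    · intro hFT
      exact hiG (subset_convexHull ℝ _ ⟨i, ⟨hi, hFT⟩, rfl⟩)

theorem BraxIx.face_of_closed {m n : ℕ} {y : ℕ → V} (h : BraxIx m n y) {U : Finset ℕ}
    (hU : ClosedIx m n U) : IsFaceOf (PQ n y) (convexHull ℝ (y '' U)) := by
  classical
  have hUn : ∀ u ∈ U, u ≤ n := fun u hu => by have := Finset.mem_range.1 (hU.1 hu); omega
  have hfac : ∀ i, i ≤ n → i ∉ U → ∃ G, IsFaceOf (PQ n y) G ∧ y '' (U : Set ℕ) ⊆ G ∧ y i ∉ G := by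
    intro i hi hiU
    rcases hU.2 i hi hiU with ⟨p, hp, h1, h2⟩ | ⟨j, hj1, hj2, h1, h2⟩
    · refine ⟨_, ((h.facet _).2 (Or.inl ⟨p, hp, rfl⟩)).1, ?_, ?_⟩
      · rintro _ ⟨u, hu, rfl⟩
        exact subset_convexHull ℝ _ ⟨u, ⟨hUn u hu, h1 u hu⟩, rfl⟩
      · intro hm
        exact h2 (h.mem_hull (fun u hu => hu.1) hi hm).2
    · refine ⟨_, ((h.facet _).2 (Or.inr ⟨j, hj1, hj2, rfl⟩)).1, ?_, ?_⟩
      · rintro _ ⟨u, hu, rfl⟩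
        exact subset_convexHull ℝ _ ⟨u, ⟨hUn u hu, h1 u hu⟩, rfl⟩
      · intro hm
        exact h2 (h.mem_hull (fun u hu => hu.1) hi hm).2
  -- the intersection of all faces containing `U`
  let K : Set V := PQ n y ∩ {z | ∀ G, IsFaceOf (PQ n y) G → y '' (U : Set ℕ) ⊆ G → z ∈ G}
  have hKE : IsExtreme ℝ (PQ n y) K := by
    refine ⟨fun z hz => hz.1, ?_⟩
    intro a ha b hb z hz hab
    refine ⟨ha, fun G hG hUG => ?_⟩
    exact hG.1.2 ha hb (hz.2 G hG hUG) hab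
  have hKC : Convex ℝ K := by
    refine (convex_convexHull ℝ _).inter ?_
    intro a ha b hb s t hs ht hst G hG hUG
    exact hG.2.1 (ha G hG hUG) (hb G hG hUG) hs ht hst
  have hK := face_eq_hull (Finset.range (n + 1)) y K hKE hKC
  have hKU : (Finset.range (n + 1)).filter (fun k => y k ∈ K) = U := by
    ext i
    rw [Finset.mem_filter, Finset.mem_range]
    constructor
    · rintro ⟨hi, hiK⟩
      by_contra hiU
      obtain ⟨G, hG, hUG, hiG⟩ := hfac i (by omega) hiU
      exact hiG (hiK.2 G hG hUG)
    · intro hi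
      have := hUn i hi
      refine ⟨by omega, subset_convexHull ℝ _ ⟨i, by simp; omega, rfl⟩, ?_⟩
      intro G hG hUG
      exact hUG ⟨i, hi, rfl⟩
  have hKU' : K = convexHull ℝ (y '' U) := by
    rw [hK]
    congr 3
    convert hKU
  rw [← hKU']
  refine ⟨hKE, hKC, ?_⟩
  rw [hKU']
  exact (U.finite_toSet.image y).isClosed_convexHull ℝ

theorem BraxIx.sdim_insert {m n : ℕ} {y : ℕ → V} (h : BraxIx m n y) {U : Finset ℕ}
    (hU : ClosedIx m n U) {i : ℕ} (hi : i ≤ n) (hiU : i ∉ U) :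
    sdim (y '' (insert i U : Finset ℕ)) = sdim (y '' U) + 1 := by
  have hUn : ∀ u ∈ U, u ≤ n := fun u hu => by have := Finset.mem_range.1 (hU.1 hu); omega
  have hF := h.face_of_closed hU
  rw [Finset.coe_insert, Set.image_insert_eq]
  refine sdim_insert_eq (U.finite_toSet.image y) ?_
  rw [← affineSpan_convexHull]
  refine notMem_affineSpan_face (Finset.range (n + 1)) y _ hF.1 hF.2.1 i (by simp; omega) ?_
  intro hm
  exact hiU (h.mem_hull (U := U) hUn hi hm)

theorem BraxIx.sdim_T {m n : ℕ} {y : ℕ → V} (h : BraxIx m n y) (hm : 1 ≤ m) (hn : m + 2 ≤ n)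
    (U : Finset ℕ) : TypeT m n U → sdim (y '' U) = (U.card : ℤ) - 1 := by
  classical
  induction U using Finset.induction_on with
  | empty => intro _; simp [sdim]
  | insert a U ha ih =>
    intro hT
    have hT' : TypeT m n U := ⟨fun u hu => hT.1 (Finset.mem_insert_of_mem hu),
      fun u hu v hv => hT.2 u (Finset.mem_insert_of_mem hu) v (Finset.mem_insert_of_mem hv)⟩
    have := Finset.mem_Icc.1 (hT.1 (Finset.mem_insert_self a U))
    rw [h.sdim_insert (closed_T hm hn hT') (by omega) ha, ih hT', Finset.card_insert_of_notMem ha]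
    push_cast; ring

theorem TypeS.typeT {m n : ℕ} {C : Finset ℕ} (hC : TypeS m n C) : TypeT m n C := by
  refine ⟨hC.1, fun u hu v hv => ?_⟩
  have h1 := Finset.mem_Icc.1 (hC.1 hu)
  have h2 := Finset.mem_Icc.1 (hC.1 hv)
  rcases hC.2 with h | h | h
  · have := h u hu v hv; omega
  · have := Finset.mem_Icc.1 (h hu)
    have := Finset.mem_Icc.1 (h hv); omega
  · have := Finset.mem_Icc.1 (h hu)
    have := Finset.mem_Icc.1 (h hv); omega

theorem TypeT.zero_notMem {m n : ℕ} {C : Finset ℕ} (hC : TypeT m n C) : 0 ∉ C := fun h => by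
  have := Finset.mem_Icc.1 (hC.1 h); omega

theorem BraxIx.sdim_S {m n : ℕ} {y : ℕ → V} (h : BraxIx m n y) (hm : 1 ≤ m) (hn : m + 2 ≤ n)
    {C : Finset ℕ} (hC : TypeT m n C) : sdim (y '' (insert 0 C : Finset ℕ)) = (C.card : ℤ) := by
  rw [h.sdim_insert (closed_T hm hn hC) (by omega) hC.zero_notMem, h.sdim_T hm hn C hC]
  ring

theorem FA_empty (m n : ℕ) : FA m n ∅ = Finset.range (n + 1) := by
  ext i
  unfold FA
  rw [Finset.mem_insert, Finset.mem_filter, Finset.mem_Icc, Finset.mem_range]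
  simp only [Finset.notMem_empty, false_imp_iff, implies_true, and_true]
  omega

theorem BraxIx.sdim_B_le {m n : ℕ} {y : ℕ → V} (h : BraxIx m n y) (hm : 1 ≤ m) (hn : m + 2 ≤ n)
    (A : Finset ℕ) : TypeB m n A → sdim (y '' (FA m n A : Finset ℕ)) ≤ (m : ℤ) + 2 - A.card := by
  classical
  induction A using Finset.induction_on with
  | empty =>
    intro _
    have := h.dim
    unfold PQ at this
    rw [sdim_convexHull] at this
    rw [FA_empty, this]
    simp
  | insert a A ha ih =>
    intro hT
    have hT' : TypeB m n A := ⟨fun u hu => hT.1 (Finset.mem_insert_of_mem hu),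
      fun u hu v hv => hT.2 u (Finset.mem_insert_of_mem hu) v (Finset.mem_insert_of_mem hv)⟩
    have ha1 := Finset.mem_Icc.1 (hT.1 (Finset.mem_insert_self a A))
    have hnot : a ∉ FA m n (insert a A) := by
      unfold FA
      rw [Finset.mem_insert, Finset.mem_filter, not_or]
      refine ⟨by omega, fun hh => ?_⟩
      exact (hh.2 a (Finset.mem_insert_self a A)).1 rfl
    have hsub : insert a (FA m n (insert a A)) ⊆ FA m n A := by
      intro u hu
      rcases Finset.mem_insert.1 hu with rfl | hu
      · unfold FA
        rw [Finset.mem_insert, Finset.mem_filter, Finset.mem_Icc]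
        refine Or.inr ⟨by omega, fun b hb => ⟨fun hh => ha (hh ▸ hb), ?_⟩⟩
        have h1 := hT.2 u (Finset.mem_insert_self u A) b (Finset.mem_insert_of_mem hb)
        have h2 := hT.2 b (Finset.mem_insert_of_mem hb) u (Finset.mem_insert_self u A)
        omega
      · unfold FA at hu ⊢
        rw [Finset.mem_insert, Finset.mem_filter] at hu ⊢
        rcases hu with hu | hu
        · exact Or.inl hu
        · exact Or.inr ⟨hu.1, fun b hb => hu.2 b (Finset.mem_insert_of_mem hb)⟩
    have e1 := h.sdim_insert (closed_B hn hT.1) (i := a) (by omega) hnot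
    have e2 : sdim (y '' (insert a (FA m n (insert a A)) : Finset ℕ)) ≤
        sdim (y '' (FA m n A : Finset ℕ)) :=
      sdim_mono ((FA m n A).finite_toSet.image y) (Set.image_mono (by exact_mod_cast hsub))
    have e3 := ih hT'
    rw [Finset.card_insert_of_notMem ha]
    push_cast
    linarith

theorem BraxIx.sdim_B {m n : ℕ} {y : ℕ → V} (h : BraxIx m n y) (hm : 1 ≤ m) (hn : m + 2 ≤ n)
    {A : Finset ℕ} (hA : TypeB m n A) :
    sdim (y '' (FA m n A : Finset ℕ)) = (m : ℤ) + 2 - A.card := by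
  classical
  refine le_antisymm (h.sdim_B_le hm hn A hA) ?_
  obtain ⟨p, hp1, hp2, hp3, hp4⟩ := exists_window hn hA
  have hW : TypeT m n (Finset.Icc p (p + m + 1) \ A) := by
    refine ⟨fun u hu => ?_, fun u hu v hv => ?_⟩
    · have := Finset.mem_Icc.1 (Finset.mem_sdiff.1 hu).1
      rw [Finset.mem_Icc]; omega
    · have := Finset.mem_Icc.1 (Finset.mem_sdiff.1 hu).1
      have := Finset.mem_Icc.1 (Finset.mem_sdiff.1 hv).1
      omega
  have hAp : A ⊆ Finset.Icc p (p + m + 1) := fun a ha => by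
    have := Finset.mem_Icc.1 (hp3 ha)
    rw [Finset.mem_Icc]; omega
  have hc : (Finset.Icc p (p + m + 1) \ A).card + A.card = m + 2 := by
    rw [Finset.card_sdiff_add_card_eq_card hAp, Nat.card_Icc]; omega
  have hsub : insert 0 (Finset.Icc p (p + m + 1) \ A) ⊆ FA m n A := by
    intro u hu
    unfold FA
    rcases Finset.mem_insert.1 hu with rfl | hu
    · exact Finset.mem_insert_self _ _
    · have h1 := Finset.mem_sdiff.1 hu
      have h2 := Finset.mem_Icc.1 h1.1
      rw [Finset.mem_insert, Finset.mem_filter, Finset.mem_Icc]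
      refine Or.inr ⟨by omega, fun a ha => ⟨fun hh => h1.2 (hh ▸ ha), hp4 a ha u h1.1⟩⟩
  have e2 : sdim (y '' (insert 0 (Finset.Icc p (p + m + 1) \ A) : Finset ℕ)) ≤
      sdim (y '' (FA m n A : Finset ℕ)) :=
    sdim_mono ((FA m n A).finite_toSet.image y) (Set.image_mono (by exact_mod_cast hsub))
  rw [h.sdim_S hm hn hW] at e2
  have : ((Finset.Icc p (p + m + 1) \ A).card : ℤ) + A.card = m + 2 := by exact_mod_cast hc
  linarith

open Classical in
/-- All index sets of faces of dimension `J - 1`. -/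
def setsAll (l n J : ℕ) : Finset (Finset ℕ) :=
  (setsT (l + 1) n J ∪
    (match J with | 0 => ∅ | J + 1 => (setsS (l + 1) n J).image (insert 0))) ∪
    (setsB (l + 1) n (l + 4 - J)).image (FA (l + 1) n)

theorem mem_setsAll {l n J : ℕ} {U : Finset ℕ} : U ∈ setsAll l n J ↔
    (TypeT (l + 1) n U ∧ U.card = J) ∨
    (∃ C, TypeS (l + 1) n C ∧ C.card + 1 = J ∧ U = insert 0 C) ∨
    (∃ A, TypeB (l + 1) n A ∧ A.card = l + 4 - J ∧ U = FA (l + 1) n A) := by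
  classical
  unfold setsAll
  rw [Finset.mem_union, Finset.mem_union, mem_setsT, or_assoc]
  refine or_congr Iff.rfl (or_congr ?_ ?_)
  · rcases J with _ | J
    · simp
    · simp only [Finset.mem_image, mem_setsS]
      constructor
      · rintro ⟨C, ⟨h1, h2⟩, rfl⟩
        exact ⟨C, h1, by omega, rfl⟩
      · rintro ⟨C, h1, h2, rfl⟩
        exact ⟨C, ⟨h1, by omega⟩, rfl⟩
  · simp only [Finset.mem_image, mem_setsB]
    constructor
    · rintro ⟨C, ⟨h1, h2⟩, rfl⟩
      exact ⟨C, h1, h2, rfl⟩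
    · rintro ⟨C, h1, h2, rfl⟩
      exact ⟨C, ⟨h1, h2⟩, rfl⟩

theorem card_setsAll (l t J : ℕ) (hJ : J ≤ l + 4) :
    (setsAll l (l + 3 + t) J).card = (l + 4).choose J + t * (chp (l + 2) J +
      (match J with | 0 => 0 | J + 1 => chp (l + 1) J)) := by
  classical
  rw [← count_total l t J hJ]
  have hz : ∀ A, 0 ∈ FA (l + 1) (l + 3 + t) A := fun A => by
    unfold FA; exact Finset.mem_insert_self _ _
  have hS : ∀ U ∈ (match J with
      | 0 => ∅ | J + 1 => (setsS (l + 1) (l + 3 + t) J).image (insert 0) : Finset (Finset ℕ)),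
      ∃ C, TypeS (l + 1) (l + 3 + t) C ∧ U = insert 0 C := by
    intro U hU
    rcases J with _ | J
    · simp at hU
    · obtain ⟨C, hC, rfl⟩ := Finset.mem_image.1 hU
      exact ⟨C, (mem_setsS.1 hC).1, rfl⟩
  unfold setsAll
  rw [Finset.card_union_of_disjoint, Finset.card_union_of_disjoint]
  · congr 1
    · congr 1
      rcases J with _ | J
      · simp
      · simp only
        refine Finset.card_image_of_injOn ?_
        intro A hA B hB hAB
        have h1 := (mem_setsS.1 hA).1.typeT.zero_notMem
        have h2 := (mem_setsS.1 hB).1.typeT.zero_notMem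
        rw [← Finset.erase_insert h1, ← Finset.erase_insert h2]
        rw [hAB]
    · refine Finset.card_image_of_injOn ?_
      intro A hA B hB hAB
      have h1 := (mem_setsB.1 hA).1
      have h2 := (mem_setsB.1 hB).1
      exact Finset.Subset.antisymm (FA_inj (by omega) h1 h2 hAB)
        (FA_inj (by omega) h2 h1 hAB.symm)
  · rw [Finset.disjoint_left]
    intro U h1 h2
    obtain ⟨C, hC, rfl⟩ := hS U h2
    exact (mem_setsT.1 h1).1.zero_notMem (Finset.mem_insert_self _ _)
  · rw [Finset.disjoint_left]
    intro U h1 h2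
    obtain ⟨A, hA, rfl⟩ := Finset.mem_image.1 h2
    rcases Finset.mem_union.1 h1 with h1 | h1
    · exact (mem_setsT.1 h1).1.zero_notMem (hz A)
    · obtain ⟨C, hC, hU⟩ := hS _ h1
      exact FA_not_S (by omega) (mem_setsB.1 hA).1 hC hU

theorem setsAll_closed {l n J : ℕ} (hn : l + 3 ≤ n) {U : Finset ℕ} (hU : U ∈ setsAll l n J) :
    ClosedIx (l + 1) n U := by
  rcases mem_setsAll.1 hU with ⟨h, -⟩ | ⟨C, h, -, rfl⟩ | ⟨A, h, -, rfl⟩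
  · exact closed_T (by omega) (by omega) h
  · exact closed_S (by omega) (by omega) h
  · exact closed_B (by omega) h.1

theorem BraxIx.faces_eq {l n : ℕ} {y : ℕ → V} (h : BraxIx (l + 1) n y) (hn : l + 3 ≤ n)
    (J : ℕ) (hJ : J ≤ l + 4) :
    {F : Set V | IsFaceOf (PQ n y) F ∧ sdim F = (J : ℤ) - 1} =
      (fun U : Finset ℕ => convexHull ℝ (y '' (U : Set ℕ))) '' (setsAll l n J : Set (Finset ℕ)) := by
  have hm : 1 ≤ l + 1 := by omega
  have hn' : l + 1 + 2 ≤ n := by omega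
  ext F
  constructor
  · rintro ⟨hF, hd⟩
    obtain ⟨U, hU, rfl⟩ := h.closed_of_face hF
    refine ⟨U, ?_, rfl⟩
    rw [sdim_convexHull] at hd
    rw [Finset.mem_coe, mem_setsAll]
    rcases classify hm hn' hU with hT | ⟨C, hC, rfl⟩ | ⟨A, hA, rfl⟩
    · left
      rw [h.sdim_T hm hn' U hT] at hd
      exact ⟨hT, by omega⟩
    · right; left
      rw [h.sdim_S hm hn' hC.typeT] at hd
      exact ⟨C, hC, by omega, rfl⟩
    · right; right
      rw [h.sdim_B hm hn' hA] at hd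
      exact ⟨A, hA, by push_cast at hd; omega, rfl⟩
  · rintro ⟨U, hU, rfl⟩
    refine ⟨h.face_of_closed (setsAll_closed hn hU), ?_⟩
    simp only
    rw [sdim_convexHull]
    rcases mem_setsAll.1 hU with ⟨hT, hc⟩ | ⟨C, hC, hc, rfl⟩ | ⟨A, hA, hc, rfl⟩
    · rw [h.sdim_T hm hn' U hT, hc]
    · rw [h.sdim_S hm hn' hC.typeT, ← hc]; push_cast; ring
    · rw [h.sdim_B hm hn' hA]
      push_cast
      omega

theorem BraxIx.ncard_faces {l t : ℕ} {y : ℕ → V} (h : BraxIx (l + 1) (l + 3 + t) y)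
    (J : ℕ) (hJ : J ≤ l + 4) :
    {F : Set V | IsFaceOf (PQ (l + 3 + t) y) F ∧ sdim F = (J : ℤ) - 1}.ncard =
      (l + 4).choose J + t * (chp (l + 2) J +
      (match J with | 0 => 0 | J + 1 => chp (l + 1) J)) := by
  rw [h.faces_eq (by omega) J hJ, Set.ncard_image_of_injOn, Set.ncard_coe_finset,
    card_setsAll l t J hJ]
  have key : ∀ U ∈ setsAll l (l + 3 + t) J, ∀ W ∈ setsAll l (l + 3 + t) J,
      convexHull ℝ (y '' (U : Set ℕ)) = convexHull ℝ (y '' (W : Set ℕ)) → U ⊆ W := by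
    intro U hU W hW he u hu
    have hUn := (setsAll_closed (by omega) hU).1
    have hWn := (setsAll_closed (by omega) hW).1
    have hm : y u ∈ convexHull ℝ (y '' (W : Set ℕ)) := by
      rw [← he]
      exact subset_convexHull ℝ _ ⟨u, hu, rfl⟩
    have hW' : ∀ w ∈ (W : Set ℕ), w ≤ l + 3 + t := fun w hw => by
      have := Finset.mem_range.1 (hWn hw); omega
    exact h.mem_hull hW' (by have := Finset.mem_range.1 (hUn hu); omega) hm
  intro U hU W hW he
  exact Finset.Subset.antisymm (key U hU W hW he) (key W hW U hU he.symm)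

theorem xc_nat {n : ℕ} (x : Fin (n + 1) → V) (i : ℕ) (hi : i ≤ n) :
    xc x (i : ℤ) = x ⟨i, by omega⟩ := by
  unfold xc
  congr 2
  omega

theorem xc_clamp {n : ℕ} (x : Fin (n + 1) → V) (s : ℤ) :
    xc x s = xc x (((min (max s 0) n).toNat : ℕ) : ℤ) := by
  rw [xc_nat x _ (by omega)]
  rfl

theorem Tset_eq {n m : ℕ} (x : Fin (n + 1) → V) (p : ℕ) (hp : p + m + 1 ≤ n) :
    Tset (m + 2) x (p : ℤ) = (fun i : ℕ => xc x (i : ℤ)) '' {i | i ≤ n ∧ FT m p i} := by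
  unfold Tset FT
  ext v
  constructor
  · rintro ⟨s, ⟨h1, h2⟩, rfl⟩
    push_cast at h2
    refine ⟨s.toNat, ⟨by omega, by omega, by omega⟩, ?_⟩
    simp only
    rw [Int.toNat_of_nonneg (by omega)]
  · rintro ⟨i, ⟨h1, h2, h3⟩, rfl⟩
    refine ⟨i, ⟨by omega, by push_cast; omega⟩, rfl⟩

theorem Eset_eq {n m : ℕ} (hm : 1 ≤ m) (x : Fin (n + 1) → V) (j : ℕ) (hj1 : 2 ≤ j)
    (hj2 : j ≤ n) :
    Eset (m + 2) x (j : ℤ) = (fun i : ℕ => xc x (i : ℤ)) '' {i | i ≤ n ∧ FE m n j i} := by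
  unfold Eset FE
  have hx0 : x 0 = xc x ((0 : ℕ) : ℤ) := by rw [xc_nat x 0 (by omega)]; rfl
  ext v
  constructor
  · rintro (rfl | ⟨s, ⟨⟨h1, h2⟩, h3⟩, rfl⟩)
    · exact ⟨0, ⟨by omega, Or.inl rfl⟩, hx0.symm⟩
    · push_cast at h1 h2
      rw [Set.mem_singleton_iff] at h3
      refine ⟨(min (max s 0) n).toNat, ⟨by omega, by omega⟩, ?_⟩
      simp only
      rw [← xc_clamp]
  · rintro ⟨i, ⟨h1, h2⟩, rfl⟩
    rcases h2 with rfl | ⟨h2, h3, h4, h5⟩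
    · left; exact hx0.symm
    · right
      by_cases hij : i = j
      · refine ⟨(n : ℤ) + 1, ⟨⟨by push_cast; omega, by push_cast; omega⟩, ?_⟩, ?_⟩
        · rw [Set.mem_singleton_iff]; omega
        · simp only
          rw [xc_clamp x ((n : ℤ) + 1)]
          congr 2
          omega
      · refine ⟨i, ⟨⟨by push_cast; omega, by push_cast; omega⟩, ?_⟩, rfl⟩
        rw [Set.mem_singleton_iff]; omega

theorem braxQ_eq {n : ℕ} (x : Fin (n + 1) → V) :
    braxQ x = PQ n (fun i : ℕ => xc x (i : ℤ)) := by
  unfold braxQ PQ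
  congr 1
  ext v
  constructor
  · rintro ⟨i, rfl⟩
    have := i.2
    refine ⟨i, by simp; omega, ?_⟩
    simp only
    rw [xc_nat x i (by omega)]
  · rintro ⟨i, hi, rfl⟩
    exact ⟨_, rfl⟩

theorem BraxIx.of_brax {l n : ℕ} (x : Fin (n + 1) → V) (hx : IsBraxtope (l + 3) n x) :
    BraxIx (l + 1) n (fun i : ℕ => xc x (i : ℤ)) := by
  obtain ⟨hn, hinj, hdim, hext, hfac⟩ := hx.2 (by omega)
  rw [braxQ_eq] at hdim
  simp only [braxQ_eq] at hext hfac
  refine ⟨?_, ?_, ?_, ?_⟩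
  · intro i hi
    have := hext ⟨i, by omega⟩
    rwa [xc_nat x i hi]
  · intro i hi j hj h
    rw [xc_nat x i hi, xc_nat x j hj] at h
    have := hinj h
    simpa using this
  · rw [hdim]
  · intro F
    rw [show l + 1 + 2 = l + 3 from rfl, hfac F]
    refine or_congr ?_ ?_
    · constructor
      · rintro ⟨i, h1, h2, rfl⟩
        push_cast at h2
        lift i to ℕ using h1
        refine ⟨i, by omega, ?_⟩
        rw [← Tset_eq x i (by omega)]
      · rintro ⟨p, h1, rfl⟩
        refine ⟨p, by omega, by push_cast; omega, ?_⟩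
        rw [← Tset_eq x p (by omega)]
    · constructor
      · rintro ⟨i, h1, h2, rfl⟩
        lift i to ℕ using (by omega)
        refine ⟨i, by omega, by omega, ?_⟩
        rw [← Eset_eq (by omega) x i (by omega) (by omega)]
      · rintro ⟨j, h1, h2, rfl⟩
        refine ⟨j, by omega, by omega, ?_⟩
        rw [← Eset_eq (by omega) x j (by omega) (by omega)]

/-- The `f`-vector of the `d`-braxtope:
`f_j = C(d+1, j+1) + (n-d) (C(d-1, j) + C(d-2, j-1))` for `-1 ≤ j ≤ d`. -/
theorem braxtope_f_vector (d n : ℕ) (hd : 3 ≤ d) (hn : d ≤ n)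
    (x : Fin (n + 1) → V) (hx : IsBraxtope d n x)
    (j : ℤ) (hj1 : -1 ≤ j) (hj2 : j ≤ d) :
    ({F : Set V | IsFaceOf (braxQ x) F ∧ sdim F = j}.ncard : ℤ) =
      zchoose ((d : ℤ) + 1) (j + 1) +
        ((n : ℤ) - d) * (zchoose ((d : ℤ) - 1) j + zchoose ((d : ℤ) - 2) (j - 1)) := by
  obtain ⟨l, rfl⟩ : ∃ l, d = l + 3 := ⟨d - 3, by omega⟩
  obtain ⟨t, rfl⟩ : ∃ t, n = l + 3 + t := ⟨n - (l + 3), by omega⟩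
  have hb := BraxIx.of_brax x hx
  obtain ⟨J, hJ⟩ : ∃ J : ℕ, j = (J : ℤ) - 1 := ⟨(j + 1).toNat, by omega⟩
  subst hJ
  rw [braxQ_eq, hb.ncard_faces J (by push_cast at hj2; omega)]
  have e1 : zchoose (((l + 3 : ℕ) : ℤ) + 1) ((J : ℤ) - 1 + 1) = ((l + 4).choose J : ℕ) := by
    unfold zchoose
    rw [if_pos (by omega)]
    congr 2 <;> omega
  have e2 : zchoose (((l + 3 : ℕ) : ℤ) - 1) ((J : ℤ) - 1) = (chp (l + 2) J : ℕ) := by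
    unfold zchoose
    rcases J with _ | J
    · simp [chp]
    · rw [if_pos (by omega)]
      simp only [chp]
      congr 2 <;> omega
  have e3 : zchoose (((l + 3 : ℕ) : ℤ) - 2) ((J : ℤ) - 1 - 1) =
      ((match J with | 0 => 0 | J + 1 => chp (l + 1) J : ℕ) : ℤ) := by
    unfold zchoose
    rcases J with _ | _ | J
    · simp
    · simp [chp]
    · rw [if_pos (by omega)]
      simp only [chp]
      congr 2 <;> omega
  rw [e1, e2, e3]
  rcases J with _ | J <;> push_cast <;> ring
end
end

section
/- The number of j-faces of a d-braxtope Q^{d,n} containing the vertex x_0 is C(d, j) + (n-d)·C(d-2, j-1), for 0 ≤ j ≤ d-1. -/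
open Set

noncomputable section

variable {V : Type*} [NormedAddCommGroup V] [NormedSpace ℝ V]

/-- Incidence relation of the vertex figure at `x_0`. -/
def BR (w n i t : ℕ) : Prop := t ≤ i + w ∧ i ≤ t + w ∧ (i = t → i = 1 ∨ i = n)

lemma BR.symm {w n i t : ℕ} (h : BR w n i t) : BR w n t i := by
  unfold BR at *; omega

open Classical in
/-- Common neighbours of `A` in `[1,n]`. -/
def perp (w n : ℕ) (A : Finset ℕ) : Finset ℕ :=
  (Finset.Icc 1 n).filter (fun t => ∀ a ∈ A, BR w n a t)

lemma mem_perp {w n : ℕ} {A : Finset ℕ} {t : ℕ} :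
    t ∈ perp w n A ↔ (1 ≤ t ∧ t ≤ n) ∧ ∀ a ∈ A, BR w n a t := by
  simp [perp]

/-- Subsets of `[1,n]` contained in a window of `w` consecutive integers. -/
def Win (w n : ℕ) (A : Finset ℕ) : Prop :=
  A ⊆ Finset.Icc 1 n ∧ ∀ a ∈ A, ∀ b ∈ A, a < b + w

lemma Win.mono {w n : ℕ} {A B : Finset ℕ} (h : Win w n B) (hAB : A ⊆ B) : Win w n A :=
  ⟨hAB.trans h.1, fun a ha b hb => h.2 a (hAB ha) b (hAB hb)⟩

lemma Win.empty {w n : ℕ} : Win w n ∅ := ⟨by simp, by simp⟩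

lemma perp_subset {w n : ℕ} {A : Finset ℕ} : perp w n A ⊆ Finset.Icc 1 n := by
  intro t ht; rw [mem_perp] at ht; simpa using ht.1

lemma perp_anti {w n : ℕ} {A B : Finset ℕ} (h : A ⊆ B) : perp w n B ⊆ perp w n A := by
  intro t ht; rw [mem_perp] at *; exact ⟨ht.1, fun a ha => ht.2 a (h ha)⟩

/-- extreme common neighbours of a nonempty window set -/
lemma Win.low {w n : ℕ} (hw : 1 ≤ w) (hn : w + 2 ≤ n) {A : Finset ℕ} (h : Win w n A)
    (hne : A.Nonempty) :
    max 1 (A.max' hne - w) ∈ perp w n A := by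
  have h1 := h.2 _ (A.max'_mem hne)
  have h2 := Finset.mem_Icc.1 (h.1 (A.max'_mem hne))
  rw [mem_perp]
  refine ⟨by omega, fun a ha => ?_⟩
  have h3 := A.le_max' a ha
  have h4 := h1 a ha
  have h5 := Finset.mem_Icc.1 (h.1 ha)
  unfold BR; omega

lemma Win.high {w n : ℕ} (hw : 1 ≤ w) (hn : w + 2 ≤ n) {A : Finset ℕ} (h : Win w n A)
    (hne : A.Nonempty) :
    min n (A.min' hne + w) ∈ perp w n A := by
  have h1 := fun a ha => h.2 a ha _ (A.min'_mem hne)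
  have h2 := Finset.mem_Icc.1 (h.1 (A.min'_mem hne))
  rw [mem_perp]
  refine ⟨by omega, fun a ha => ?_⟩
  have h3 := A.min'_le a ha
  have h4 := h1 a ha
  have h5 := Finset.mem_Icc.1 (h.1 ha)
  unfold BR; omega

lemma perp_not_win {w n : ℕ} (hw : 1 ≤ w) (hn : w + 2 ≤ n) {A : Finset ℕ} (h : Win w n A)
    (hne : A.Nonempty) : ¬ Win w n (perp w n A) := by
  intro hp
  have h1 := hp.2 _ (h.high hw hn hne) _ (h.low hw hn hne)
  have h2 := Finset.mem_Icc.1 (h.1 (A.min'_mem hne))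
  have h3 := Finset.mem_Icc.1 (h.1 (A.max'_mem hne))
  have h4 := h.2 _ (A.max'_mem hne) _ (A.min'_mem hne)
  omega

lemma perp_nonempty {w n : ℕ} (hw : 1 ≤ w) (hn : w + 2 ≤ n) {A : Finset ℕ} (h : Win w n A) :
    (perp w n A).Nonempty := by
  rcases A.eq_empty_or_nonempty with rfl | hne
  · exact ⟨1, by rw [mem_perp]; simp; omega⟩
  · exact ⟨_, h.low hw hn hne⟩

lemma perp_perp {w n : ℕ} (hw : 1 ≤ w) (hn : w + 2 ≤ n) {S : Finset ℕ} (h : Win w n S) :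
    perp w n (perp w n S) = S := by
  apply Finset.Subset.antisymm
  · intro t ht
    rw [mem_perp] at ht
    obtain ⟨ht1, ht2⟩ := ht
    by_contra hts
    by_cases hinn : t ∈ perp w n S ∧ t ≠ 1 ∧ t ≠ n
    · have := ht2 t hinn.1
      unfold BR at this; omega
    rcases S.eq_empty_or_nonempty with rfl | hne
    · have e1 := ht2 1 (by rw [mem_perp]; simp; omega)
      have e2 := ht2 n (by rw [mem_perp]; simp; omega)
      have e3 : t ∈ perp w n ∅ := by rw [mem_perp]; simp; omega
      unfold BR at e1 e2
      have : ¬ (t ≠ 1 ∧ t ≠ n) := fun q => hinn ⟨e3, q⟩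
      omega
    · have el := ht2 _ (h.low hw hn hne)
      have eh := ht2 _ (h.high hw hn hne)
      have m1 := S.min'_mem hne
      have m2 := S.max'_mem hne
      have h2 := Finset.mem_Icc.1 (h.1 m1)
      have h3 := Finset.mem_Icc.1 (h.1 m2)
      have h4 := h.2 _ m2 _ m1
      have n1 : t ≠ S.min' hne := fun q => hts (q ▸ m1)
      have n2 : t ≠ S.max' hne := fun q => hts (q ▸ m2)
      have mm := S.min'_le _ m2
      unfold BR at el eh
      by_cases hb : t ≠ 1 ∧ t ≠ n
      · have : t ∉ perp w n S := fun q => hinn ⟨q, hb⟩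
        apply this
        rw [mem_perp]
        refine ⟨ht1, fun a ha => ?_⟩
        have a1 := S.min'_le _ ha
        have a2 := S.le_max' _ ha
        have : a ≠ t := fun q => hts (q ▸ ha)
        unfold BR
        omega
      · omega
  · intro s hs
    rw [mem_perp]
    exact ⟨Finset.mem_Icc.1 (h.1 hs), fun a ha => ((mem_perp.1 ha).2 s hs).symm⟩

lemma perp_cases {w n : ℕ} (hw : 1 ≤ w) (hn : w + 2 ≤ n) {B : Finset ℕ}
    (hB : B ⊆ Finset.Icc 1 n) (hne : B.Nonempty) :
    Win w n B ∨ Win w n (perp w n B) := by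
  by_contra hcon
  push Not at hcon
  obtain ⟨c1, c2⟩ := hcon
  have m1 := B.min'_mem hne
  have m2 := B.max'_mem hne
  have h2 := Finset.mem_Icc.1 (hB m1)
  have h3 := Finset.mem_Icc.1 (hB m2)
  have hs : B.min' hne + w ≤ B.max' hne := by
    by_contra hlt
    apply c1
    refine ⟨hB, fun a ha b hb => ?_⟩
    have a1 := B.le_max' _ ha
    have a2 := B.min'_le _ hb
    omega
  apply c2
  refine ⟨perp_subset, fun a ha b hb => ?_⟩
  have a1 := (mem_perp.1 ha).2 _ m1
  have a2 := (mem_perp.1 ha).2 _ m2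
  have b1 := (mem_perp.1 hb).2 _ m1
  have b2 := (mem_perp.1 hb).2 _ m2
  unfold BR at *
  omega

lemma Win.extend {w n : ℕ} (hw : 1 ≤ w) (hn : w + 2 ≤ n) {A : Finset ℕ} (h : Win w n A)
    (hne : A.Nonempty) : ∃ B, Win w n B ∧ A ⊆ B ∧ B.card = w := by
  have m1 := A.min'_mem hne
  have h2 := Finset.mem_Icc.1 (h.1 m1)
  refine ⟨Finset.Icc (min (A.min' hne) (n + 1 - w)) (min (A.min' hne) (n + 1 - w) + w - 1),
    ⟨?_, ?_⟩, ?_, ?_⟩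
  · intro t ht; rw [Finset.mem_Icc] at *; omega
  · intro a ha b hb; rw [Finset.mem_Icc] at *; omega
  · intro t ht
    have a1 := A.min'_le _ ht
    have a2 := h.2 _ ht _ m1
    have a3 := Finset.mem_Icc.1 (h.1 ht)
    rw [Finset.mem_Icc]; omega
  · rw [Nat.card_Icc]; omega

open Classical in
/-- window sets of given size -/
def WinF (w n m : ℕ) : Finset (Finset ℕ) :=
  ((Finset.Icc 1 n).powersetCard m).filter (Win w n)

lemma mem_WinF {w n m : ℕ} {A : Finset ℕ} : A ∈ WinF w n m ↔ Win w n A ∧ A.card = m := by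
  simp only [WinF, Finset.mem_filter, Finset.mem_powersetCard]
  constructor
  · rintro ⟨⟨_, h⟩, h'⟩; exact ⟨h', h⟩
  · rintro ⟨h, h'⟩; exact ⟨⟨h.1, h'⟩, h⟩

lemma card_WinF_zero (w n : ℕ) : (WinF w n 0).card = 1 := by
  rw [Finset.card_eq_one]
  refine ⟨∅, ?_⟩
  ext A
  rw [mem_WinF, Finset.mem_singleton, Finset.card_eq_zero]
  constructor
  · exact fun h => h.2
  · rintro rfl; exact ⟨Win.empty, rfl⟩

lemma card_WinF_succ (w n m : ℕ) (hw : 1 ≤ w) (hn : w ≤ n) :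
    (WinF w n (m + 1)).card = w.choose (m + 1) + (n - w) * (w - 1).choose m := by
  induction n, hn using Nat.le_induction with
  | base =>
    have : WinF w w (m + 1) = (Finset.Icc 1 w).powersetCard (m + 1) := by
      ext A
      rw [mem_WinF, Finset.mem_powersetCard]
      constructor
      · exact fun h => ⟨h.1.1, h.2⟩
      · rintro ⟨h, h'⟩
        refine ⟨⟨h, fun a ha b hb => ?_⟩, h'⟩
        have := Finset.mem_Icc.1 (h ha)
        have := Finset.mem_Icc.1 (h hb)
        omega
    rw [this]; simp
  | succ n hn ih =>
    have key : WinF w (n + 1) (m + 1) = WinF w n (m + 1) ∪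
        ((Finset.Icc (n + 2 - w) n).powersetCard m).image (fun A => insert (n + 1) A) := by
      ext A
      simp only [Finset.mem_union, mem_WinF, Finset.mem_image, Finset.mem_powersetCard]
      constructor
      · rintro ⟨⟨h1, h2⟩, h3⟩
        by_cases hA : n + 1 ∈ A
        · right
          refine ⟨A.erase (n + 1), ⟨?_, ?_⟩, Finset.insert_erase hA⟩
          · intro t ht
            rw [Finset.mem_erase] at ht
            have := Finset.mem_Icc.1 (h1 ht.2)
            have := h2 _ hA _ ht.2
            rw [Finset.mem_Icc]; omega
          · rw [Finset.card_erase_of_mem hA]; omega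
        · left
          refine ⟨⟨?_, h2⟩, h3⟩
          intro t ht
          have := Finset.mem_Icc.1 (h1 ht)
          have : t ≠ n + 1 := fun q => hA (q ▸ ht)
          rw [Finset.mem_Icc]; omega
      · rintro (⟨⟨h1, h2⟩, h3⟩ | ⟨B, ⟨h1, h2⟩, rfl⟩)
        · exact ⟨⟨h1.trans (Finset.Icc_subset_Icc_right (by omega)), h2⟩, h3⟩
        · have hB : ∀ t ∈ B, n + 2 - w ≤ t ∧ t ≤ n := fun t ht => Finset.mem_Icc.1 (h1 ht)
          refine ⟨⟨?_, ?_⟩, ?_⟩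
          · intro t ht
            rw [Finset.mem_insert] at ht
            rw [Finset.mem_Icc]
            rcases ht with rfl | ht
            · omega
            · have := hB t ht; omega
          · intro a ha b hb
            rw [Finset.mem_insert] at ha hb
            rcases ha with rfl | ha <;> rcases hb with rfl | hb
            · omega
            · have := hB _ hb; omega
            · have := hB _ ha; omega
            · have := hB _ hb; have := hB _ ha; omega
          · rw [Finset.card_insert_of_notMem, h2]
            intro q; have := hB _ q; omega
    rw [key, Finset.card_union_of_disjoint, ih, Finset.card_image_of_injOn,
      Finset.card_powersetCard, Nat.card_Icc]
    · have e1 : n + 1 - (n + 2 - w) = w - 1 := by omega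
      have e2 : n + 1 - w = (n - w) + 1 := by omega
      rw [e1, e2]; ring
    · intro A hA B hB hAB
      have nA : n + 1 ∉ A := fun q => by
        have := Finset.mem_Icc.1 ((Finset.mem_powersetCard.1 hA).1 q); omega
      have nB : n + 1 ∉ B := fun q => by
        have := Finset.mem_Icc.1 ((Finset.mem_powersetCard.1 hB).1 q); omega
      have := congrArg (fun C => Finset.erase C (n + 1)) hAB
      simpa [Finset.erase_insert nA, Finset.erase_insert nB] using this
    · rw [Finset.disjoint_left]
      intro A hA hA'
      rw [Finset.mem_image] at hA'
      obtain ⟨B, _, rfl⟩ := hA'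
      have := Finset.mem_Icc.1 ((mem_WinF.1 hA).1.1 (Finset.mem_insert_self _ _))
      omega

lemma count_final (d n j : ℕ) (hd : 3 ≤ d) (hn : d ≤ n) (hj : j ≤ d - 1) :
    (((WinF (d - 2) n j).card + (WinF (d - 2) n (d - j)).card : ℕ) : ℤ) =
      zchoose (d : ℤ) j + ((n : ℤ) - d) * zchoose ((d : ℤ) - 2) ((j : ℤ) - 1) := by
  obtain ⟨e, rfl⟩ : ∃ e, d = e + 3 := ⟨d - 3, by omega⟩
  obtain ⟨r, rfl⟩ : ∃ r, n = e + 3 + r := ⟨n - (e + 3), by omega⟩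
  have q1 : ((e + 3 : ℕ) : ℤ).toNat = e + 3 := by omega
  have q2 : (((e + 3 : ℕ) : ℤ) - 2).toNat = e + 1 := by omega
  have q3 : e + 3 - 2 = e + 1 := by omega
  have q4 : e + 1 - 1 = e := by omega
  have q5 : e + 3 + r - (e + 1) = r + 2 := by omega
  rw [q3]
  rcases j with _ | _ | j
  · rw [card_WinF_zero, Nat.sub_zero, card_WinF_succ _ _ _ (by omega) (by omega)]
    rw [Nat.choose_eq_zero_of_lt (by omega), Nat.choose_eq_zero_of_lt (by omega)]
    simp [zchoose]
  · have : e + 3 - (0 + 1) = (e + 1) + 1 := by omega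
    rw [this, card_WinF_succ _ _ _ (by omega) (by omega), card_WinF_succ _ _ _ (by omega) (by omega)]
    rw [q4, q5, Nat.choose_eq_zero_of_lt (show e + 1 < e + 1 + 1 by omega),
      Nat.choose_eq_zero_of_lt (show e < e + 1 by omega)]
    simp [zchoose]
    omega
  · have hje : j ≤ e := by omega
    have : e + 3 - (j + 1 + 1) = (e - j) + 1 := by omega
    rw [this, card_WinF_succ _ _ _ (by omega) (by omega), card_WinF_succ _ _ _ (by omega) (by omega)]
    have z1 : zchoose ((e + 3 : ℕ) : ℤ) ((j + 1 + 1 : ℕ) : ℤ) = ((e + 3).choose (j + 2) : ℕ) := by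
      rw [zchoose, if_pos (by omega), q1]; rfl
    have z2 : zchoose (((e + 3 : ℕ) : ℤ) - 2) (((j + 1 + 1 : ℕ) : ℤ) - 1)
        = ((e + 1).choose (j + 1) : ℕ) := by
      rw [zchoose, if_pos (by omega), q2]
      congr 2; omega
    have s1 : e.choose (e - j) = e.choose j := Nat.choose_symm hje
    have s2 : (e + 1).choose (e - j + 1) = (e + 1).choose j := by
      rw [show e - j + 1 = e + 1 - j by omega]; exact Nat.choose_symm (by omega)
    rw [z1, z2, q4, q5, s1, s2]
    have p1 : (e + 3).choose (j + 2) = (e + 1).choose j + 2 * (e + 1).choose (j + 1)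
        + (e + 1).choose (j + 2) := by
      rw [Nat.choose_succ_succ' (e + 2), Nat.choose_succ_succ' (e + 1), Nat.choose_succ_succ' (e + 1)]
      ring
    have p2 : (e + 1).choose (j + 1) = e.choose j + e.choose (j + 1) := Nat.choose_succ_succ' e j
    have p3 : (e + 1).choose (j + 1 + 1) = (e + 1).choose (j + 2) := rfl
    rw [p3, p1, p2]
    push_cast
    ring

lemma extreme_affine {Q F : Set V} (hE : IsExtreme ℝ Q F) (hc : Convex ℝ F) {y : V}
    (hy : y ∈ Q) (hya : y ∈ affineSpan ℝ F) : y ∈ F := by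
  have hya' : y ∈ affineSpan ℝ (Set.range (Subtype.val : F → V)) := by simpa using hya
  obtain ⟨s, w, hw, hyw⟩ := eq_affineCombination_of_mem_affineSpan hya'
  rw [Finset.affineCombination_eq_linear_combination _ _ _ hw] at hyw
  set P : ℝ := ∑ i ∈ s, max (w i) 0 with hP
  set N : ℝ := ∑ i ∈ s, max (-w i) 0 with hN
  have hPN : P - N = 1 := by
    rw [hP, hN, ← Finset.sum_sub_distrib, ← hw]
    refine Finset.sum_congr rfl fun i _ => ?_
    exact max_zero_sub_max_neg_zero_eq_self (w i)
  have hN0 : 0 ≤ N := Finset.sum_nonneg fun i _ => le_max_right _ _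
  have hPpos : 0 < P := by linarith
  have hp : s.centerMass (fun i => max (w i) 0) (Subtype.val : F → V) ∈ F :=
    hc.centerMass_mem (fun i _ => le_max_right _ _) hPpos (fun i _ => i.2)
  set p := s.centerMass (fun i => max (w i) 0) (Subtype.val : F → V) with hpdef
  have hPp : P • p = ∑ i ∈ s, max (w i) 0 • (i : V) := by
    rw [hpdef, Finset.centerMass, smul_inv_smul₀ hPpos.ne']
  have hsplit : y = P • p - ∑ i ∈ s, max (-w i) 0 • (i : V) := by
    rw [hPp, hyw, ← Finset.sum_sub_distrib]
    refine Finset.sum_congr rfl fun i _ => ?_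
    rw [← sub_smul, max_zero_sub_max_neg_zero_eq_self]
  rcases hN0.eq_or_lt with h0 | hpos
  · have hz : ∑ i ∈ s, max (-w i) 0 • (i : V) = 0 := by
      refine Finset.sum_eq_zero fun i hi => ?_
      rw [(Finset.sum_eq_zero_iff_of_nonneg (fun i _ => le_max_right _ _)).1 h0.symm i hi,
        zero_smul]
    have : P = 1 := by linarith
    rw [hsplit, hz, this]; simpa using hp
  · have hq : s.centerMass (fun i => max (-w i) 0) (Subtype.val : F → V) ∈ F :=
      hc.centerMass_mem (fun i _ => le_max_right _ _) hpos (fun i _ => i.2)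
    set q := s.centerMass (fun i => max (-w i) 0) (Subtype.val : F → V) with hqdef
    have hNq : N • q = ∑ i ∈ s, max (-w i) 0 • (i : V) := by
      rw [hqdef, Finset.centerMass, smul_inv_smul₀ hpos.ne']
    rw [← hNq] at hsplit
    refine hE.2 hy (hE.1 hq) hp ⟨1 / P, N / P, by positivity, by positivity, ?_, ?_⟩
    · field_simp; linarith
    · rw [hsplit, smul_sub, smul_smul, smul_smul]
      rw [show 1 / P * P = 1 by field_simp, show 1 / P * N = N / P by ring]
      simp

lemma face_eq_hull_s13 {n : ℕ} (x : Fin (n + 1) → V) {F : Set V} (hE : IsExtreme ℝ (braxQ x) F)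
    (hc : Convex ℝ F) (h0 : x 0 ∈ F) : F = convexHull ℝ (x '' {i | x i ∈ F}) := by
  apply Set.Subset.antisymm
  · intro y hy
    have hyQ : y ∈ convexHull ℝ (Set.range x) := hE.1 hy
    have hun : Set.range x = x '' {i | x i ∈ F} ∪ x '' {i | x i ∉ F} := by
      rw [← Set.image_union, ← Set.image_univ]
      congr 1
      ext i; simp [em]
    by_cases hne : (x '' {i | x i ∉ F}).Nonempty
    · rw [hun, convexHull_union (show (x '' {i | x i ∈ F}).Nonempty from ⟨x 0, 0, h0, rfl⟩) hne, mem_convexJoin] at hyQ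
      obtain ⟨p, hp, q, hq, hyq⟩ := hyQ
      have hqd : q ∈ braxQ x \ F := by
        refine convexHull_min ?_ (hE.convex_sdiff (convex_convexHull ℝ _)) hq
        rintro _ ⟨i, hi, rfl⟩
        exact ⟨subset_convexHull ℝ _ ⟨i, rfl⟩, hi⟩
      have hpF : p ∈ F := convexHull_min (by rintro _ ⟨i, hi, rfl⟩; exact hi) hc hp
      by_cases hpy : p = y
      · rwa [← hpy]
      by_cases hqy : q = y
      · exact absurd hy (hqy ▸ hqd.2)
      exfalso
      apply hqd.2
      have hop : y ∈ openSegment ℝ p q := mem_openSegment_of_ne_left_right hpy hqy hyq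
      rw [openSegment_symm] at hop
      exact hE.2 hqd.1 (hE.1 hpF) hy hop
    · rw [Set.not_nonempty_iff_eq_empty] at hne
      rwa [hun, hne, Set.union_empty] at hyQ
  · exact convexHull_min (by rintro _ ⟨i, hi, rfl⟩; exact hi) hc

lemma mem_hull_iff {n : ℕ} {x : Fin (n + 1) → V} (hinj : Function.Injective x)
    (hext : ∀ i, x i ∈ Set.extremePoints ℝ (braxQ x)) (S : Set (Fin (n + 1))) (i : Fin (n + 1)) :
    x i ∈ convexHull ℝ (x '' S) ↔ i ∈ S := by
  constructor
  · intro h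
    have hsub : convexHull ℝ (x '' S) ⊆ braxQ x := convexHull_mono (Set.image_subset_range _ _)
    have h1 := inter_extremePoints_subset_extremePoints_of_subset hsub ⟨h, hext i⟩
    obtain ⟨k, hk, hki⟩ := extremePoints_convexHull_subset h1
    exact hinj hki ▸ hk
  · intro h; exact subset_convexHull ℝ _ ⟨i, h, rfl⟩

lemma findim_dir {n : ℕ} (x : Fin (n + 1) → V) {G : Set V} (h : G ⊆ braxQ x) :
    FiniteDimensional ℝ (affineSpan ℝ G).direction := by
  have h1 : affineSpan ℝ G ≤ affineSpan ℝ (Set.range x) := by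
    rw [← affineSpan_convexHull (Set.range x)]
    exact affineSpan_mono ℝ h
  have : FiniteDimensional ℝ (affineSpan ℝ (Set.range x)).direction :=
    finiteDimensional_direction_affineSpan_of_finite ℝ (Set.finite_range x)
  exact Submodule.finiteDimensional_of_le (AffineSubspace.direction_le h1)

lemma sdim_strict {n : ℕ} (x : Fin (n + 1) → V) {F G : Set V} (hF : IsFaceOf (braxQ x) F)
    (hG : IsFaceOf (braxQ x) G) (hne : F.Nonempty) (hFG : F ⊆ G) (hneq : F ≠ G) :
    sdim F < sdim G := by
  have := findim_dir x hG.1.1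
  rw [sdim, sdim, if_pos hne, if_pos (hne.mono hFG)]
  have hle : affineSpan ℝ F ≤ affineSpan ℝ G := affineSpan_mono ℝ hFG
  have hdl := AffineSubspace.direction_le hle
  have hlt : (affineSpan ℝ F).direction < (affineSpan ℝ G).direction := by
    refine lt_of_le_of_ne hdl fun heq => hneq ?_
    have hs : affineSpan ℝ F = affineSpan ℝ G :=
      AffineSubspace.eq_of_direction_eq_of_nonempty_of_le heq
        ((affineSpan_nonempty ℝ).2 hne) hle
    refine hFG.antisymm fun y hy => ?_
    exact extreme_affine hF.1 hF.2.1 (hG.1.1 hy) (hs ▸ subset_affineSpan ℝ _ hy)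
  exact_mod_cast Submodule.finrank_lt_finrank_of_lt hlt

lemma exists_functional {n : ℕ} (x : Fin (n + 1) → V) {F : Set V} (hF : IsFaceOf (braxQ x) F)
    (h0 : x 0 ∈ F) : ∃ l : V →ₗ[ℝ] ℝ, (∀ i, x i ∈ F → l (x i - x 0) = 0) ∧
      ∀ i, x i ∉ F → 0 < l (x i - x 0) := by
  have := findim_dir x hF.1.1
  have hdisj : Disjoint (convexHull ℝ (x '' {i | x i ∉ F})) (affineSpan ℝ F : Set V) := by
    rw [Set.disjoint_left]
    intro q hq hqa
    have hqd : q ∈ braxQ x \ F := by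
      refine convexHull_min ?_ (hF.1.convex_sdiff (convex_convexHull ℝ _)) hq
      rintro _ ⟨i, hi, rfl⟩
      exact ⟨subset_convexHull ℝ _ ⟨i, rfl⟩, hi⟩
    exact hqd.2 (extreme_affine hF.1 hF.2.1 hqd.1 hqa)
  have hcl : IsClosed (affineSpan ℝ F : Set V) :=
    AffineSubspace.closed_of_finiteDimensional _
  obtain ⟨f, u, v, h1, h2, h3⟩ := geometric_hahn_banach_compact_closed (convex_convexHull ℝ _)
    (Set.Finite.isCompact_convexHull ℝ (Set.toFinite _))
    (AffineSubspace.convex (affineSpan ℝ F)) hcl hdisj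
  have hz : ∀ i, x i ∈ F → f (x i - x 0) = 0 := by
    intro i hi
    by_contra hne
    have hm : ∀ t : ℝ, x 0 + t • (x i - x 0) ∈ affineSpan ℝ F := by
      intro t
      have := AffineMap.lineMap_mem t (mem_affineSpan ℝ h0) (mem_affineSpan ℝ hi)
      rw [AffineMap.lineMap_apply] at this
      simpa [add_comm] using this
    have := h3 _ (hm ((v - f (x 0)) / f (x i - x 0)))
    rw [map_add, map_smul, smul_eq_mul, div_mul_cancel₀ _ hne] at this
    linarith
  refine ⟨-f.toLinearMap, fun i hi => ?_, fun i hi => ?_⟩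
  · rw [LinearMap.neg_apply]; exact neg_eq_zero.2 (hz i hi)
  · have a1 := h1 (x i) (subset_convexHull ℝ _ ⟨i, hi, rfl⟩)
    have a2 := h3 (x 0) (mem_affineSpan ℝ h0)
    simp
    linarith

lemma exists_facet_s13 {n d : ℕ} (x : Fin (n + 1) → V) (hdim : sdim (braxQ x) = d) {F : Set V}
    (hF : IsFaceOf (braxQ x) F) (h0 : x 0 ∈ F) (k : Fin (n + 1)) (hk : x k ∉ F) :
    ∃ G, IsFacetOf d (braxQ x) G ∧ F ⊆ G ∧ x k ∉ G := by
  classical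
  let Good : (V →ₗ[ℝ] ℝ) → Prop := fun l => (∀ i, 0 ≤ l (x i - x 0)) ∧
    (∀ i, x i ∈ F → l (x i - x 0) = 0) ∧ 0 < l (x k - x 0)
  let zs : (V →ₗ[ℝ] ℝ) → Finset (Fin (n + 1)) := fun l =>
    Finset.univ.filter fun i => l (x i - x 0) = 0
  obtain ⟨l0, hl1, hl2⟩ := exists_functional x hF h0
  have hgood0 : Good l0 := by
    refine ⟨fun i => ?_, hl1, hl2 k hk⟩
    by_cases hi : x i ∈ F
    · exact (hl1 i hi).ge
    · exact (hl2 i hi).le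
  obtain ⟨Z, hZ⟩ := (Set.toFinite {Z | ∃ l, Good l ∧ Z = zs l}).exists_maximal
    ⟨zs l0, l0, hgood0, rfl⟩
  obtain ⟨⟨l, ⟨hnn, hlF, hlk⟩, hZl⟩, hmax⟩ := hZ
  have hmemZ : ∀ i, i ∈ Z ↔ l (x i - x 0) = 0 := by intro i; rw [hZl]; simp [zs]
  let G : Set V := braxQ x ∩ {y | l (y - x 0) = 0}
  have hlQ : ∀ y ∈ braxQ x, 0 ≤ l (y - x 0) := by
    have hcv : Convex ℝ {y | 0 ≤ l (y - x 0)} := by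
      have : {y | 0 ≤ l (y - x 0)} = {y | l (x 0) ≤ l y} := by ext y; simp
      rw [this]
      exact convex_halfSpace_ge l.isLinear _
    intro y hy
    exact convexHull_min (by rintro _ ⟨i, rfl⟩; exact hnn i) hcv hy
  have hGE : IsExtreme ℝ (braxQ x) G := by
    refine ⟨Set.inter_subset_left, ?_⟩
    rintro p hp q hq z ⟨hz1, hz2⟩ ⟨a, b, ha, hb, hab, rfl⟩
    refine ⟨hp, ?_⟩
    have e : a • p + b • q - x 0 = a • (p - x 0) + b • (q - x 0) := by
      have : x 0 = a • x 0 + b • x 0 := by rw [← add_smul, hab, one_smul]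
      nth_rw 1 [this]
      simp only [smul_sub]; abel
    change l (a • p + b • q - x 0) = 0 at hz2
    rw [e, map_add, map_smul, map_smul, smul_eq_mul, smul_eq_mul] at hz2
    have a1 := hlQ p hp
    have a2 := hlQ q hq
    change l (p - x 0) = 0
    nlinarith [mul_nonneg ha.le a1, mul_nonneg hb.le a2]
  have hGc : Convex ℝ G := by
    refine (convex_convexHull ℝ _).inter ?_
    have : {y | l (y - x 0) = 0} = {y | l y = l (x 0)} := by ext y; simp [sub_eq_zero]
    rw [this]
    exact convex_hyperplane l.isLinear _
  have hx0Q : x 0 ∈ braxQ x := subset_convexHull ℝ _ ⟨0, rfl⟩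
  have h0G : x 0 ∈ G := ⟨hx0Q, by simp⟩
  have hGh := face_eq_hull_s13 x hGE hGc h0G
  have hidx : {i | x i ∈ G} = (Z : Set (Fin (n + 1))) := by
    ext i
    have hi : x i ∈ braxQ x := subset_convexHull ℝ _ ⟨i, rfl⟩
    simp [G, hmemZ, hi]
  rw [hidx] at hGh
  have hcl : IsClosed G := by
    rw [hGh]; exact Set.Finite.isClosed_convexHull ℝ (Set.toFinite _)
  have h0Z : (0 : Fin (n + 1)) ∈ Z := by rw [hmemZ]; simp
  refine ⟨G, ⟨⟨hGE, hGc, hcl⟩, ?_⟩, ?_, ?_⟩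
  · have hdW : Module.finrank ℝ (vectorSpan ℝ (Set.range x)) = d := by
      rw [sdim, if_pos ⟨_, hx0Q⟩, braxQ, affineSpan_convexHull, direction_affineSpan] at hdim
      exact_mod_cast hdim
    rw [sdim, if_pos ⟨_, h0G⟩, hGh, affineSpan_convexHull, direction_affineSpan]
    set U := vectorSpan ℝ (x '' (Z : Set (Fin (n + 1)))) with hU
    set W := vectorSpan ℝ (Set.range x) with hW
    have fU : FiniteDimensional ℝ U := finiteDimensional_vectorSpan_of_finite ℝ (Set.toFinite _)
    have fW : FiniteDimensional ℝ W := finiteDimensional_vectorSpan_of_finite ℝ (Set.toFinite _)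
    have hUle : U ≤ W := vectorSpan_mono ℝ (Set.image_subset_range _ _)
    have hUker : U ≤ LinearMap.ker l := by
      rw [hU, vectorSpan_eq_span_vsub_set_right ℝ (show x 0 ∈ x '' (Z : Set _) from ⟨0, h0Z, rfl⟩),
        Submodule.span_le]
      rintro _ ⟨_, ⟨i, hi, rfl⟩, rfl⟩
      exact (hmemZ i).1 hi
    have hvW : x k - x 0 ∈ W := vsub_mem_vectorSpan ℝ ⟨k, rfl⟩ ⟨0, rfl⟩
    have hUlt : U < W := by
      refine lt_of_le_of_ne hUle fun h => ?_
      have := hUker (h ▸ hvW)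
      rw [LinearMap.mem_ker] at this
      exact hlk.ne' this
    have hlt := Submodule.finrank_lt_finrank_of_lt hUlt
    have hge : d ≤ Module.finrank ℝ U + 1 := by
      by_contra hcon
      push Not at hcon
      have hsup : Module.finrank ℝ (U ⊔ Submodule.span ℝ {x k - x 0} : Submodule ℝ V) < d := by
        have a1 := Submodule.finrank_add_le_finrank_add_finrank U (Submodule.span ℝ {x k - x 0})
        have a2 := finrank_span_le_card (R := ℝ) ({x k - x 0} : Set V)
        simp at a2
        omega
      have hex : ∃ i, x i - x 0 ∉ U ⊔ Submodule.span ℝ {x k - x 0} := by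
        by_contra hall
        push Not at hall
        have : W ≤ U ⊔ Submodule.span ℝ {x k - x 0} := by
          rw [hW, vectorSpan_eq_span_vsub_set_right ℝ (show x 0 ∈ Set.range x from ⟨0, rfl⟩),
            Submodule.span_le]
          rintro _ ⟨_, ⟨i, rfl⟩, rfl⟩
          exact hall i
        have := Submodule.finrank_mono this
        omega
      obtain ⟨i0, hi0⟩ := hex
      obtain ⟨m, hm, hmker⟩ : ∃ m : V →ₗ[ℝ] ℝ, m (x i0 - x 0) < 0 ∧
          U ⊔ Submodule.span ℝ {x k - x 0} ≤ LinearMap.ker m := by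
        obtain ⟨m, hm, hmk⟩ := Submodule.exists_le_ker_of_notMem hi0
        rcases lt_or_gt_of_ne hm with h | h
        · exact ⟨m, h, hmk⟩
        · refine ⟨-m, by simpa using h, fun y hy => ?_⟩
          have := hmk hy
          rw [LinearMap.mem_ker] at *
          simp [this]
      have hmZ : ∀ i ∈ Z, m (x i - x 0) = 0 := fun i hi =>
        hmker (Submodule.mem_sup_left (vsub_mem_vectorSpan ℝ ⟨i, hi, rfl⟩ ⟨0, h0Z, rfl⟩))
      have hmk : m (x k - x 0) = 0 :=
        hmker (Submodule.mem_sup_right (Submodule.mem_span_singleton_self _))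
      obtain ⟨i1, hi1, hmin⟩ := (Finset.univ.filter fun i => m (x i - x 0) < 0).exists_min_image
        (fun i => l (x i - x 0) / (-m (x i - x 0))) ⟨i0, by simpa using hm⟩
      simp only [Finset.mem_filter, Finset.mem_univ, true_and] at hi1 hmin
      set t := l (x i1 - x 0) / (-m (x i1 - x 0)) with ht
      have ht0 : 0 ≤ t := div_nonneg (hnn i1) (by linarith)
      have hg : Good (l + t • m) := by
        refine ⟨fun i => ?_, fun i hi => ?_, ?_⟩
        · simp only [LinearMap.add_apply, LinearMap.smul_apply, smul_eq_mul]
          rcases lt_or_ge (m (x i - x 0)) 0 with h | h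
          · have := hmin i h
            rw [le_div_iff₀ (by linarith)] at this
            linarith
          · have := hnn i; positivity
        · simp only [LinearMap.add_apply, LinearMap.smul_apply, smul_eq_mul]
          rw [hlF i hi, hmZ i ((hmemZ i).2 (hlF i hi))]; simp
        · simp only [LinearMap.add_apply, LinearMap.smul_apply, smul_eq_mul]
          rw [hmk]; simpa using hlk
      have hsub : Z ⊆ zs (l + t • m) := by
        intro i hi
        simp only [zs, Finset.mem_filter, Finset.mem_univ, true_and, LinearMap.add_apply,
          LinearMap.smul_apply, smul_eq_mul]
        rw [(hmemZ i).1 hi, hmZ i hi]; simp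
      have hi1Z : i1 ∈ zs (l + t • m) := by
        simp only [zs, Finset.mem_filter, Finset.mem_univ, true_and, LinearMap.add_apply,
          LinearMap.smul_apply, smul_eq_mul]
        rw [ht, div_mul_eq_mul_div, div_neg, mul_div_assoc, div_self hi1.ne]; ring
      have := hmZ i1 (hmax ⟨_, hg, rfl⟩ hsub hi1Z)
      linarith
    omega
  · rw [face_eq_hull_s13 x hF.1 hF.2.1 h0]
    refine convexHull_min ?_ hGc
    rintro _ ⟨i, hi, rfl⟩
    exact ⟨subset_convexHull ℝ _ ⟨i, rfl⟩, hlF i hi⟩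
  · rintro ⟨_, h⟩
    exact hlk.ne' h

/-- The hull of `x_0` and the vertices indexed by `S`. -/
def PF {n : ℕ} (x : Fin (n + 1) → V) (S : Finset ℕ) : Set V :=
  convexHull ℝ (x '' {i | i = 0 ∨ (i : ℕ) ∈ S})

/-- Clamped index. -/
def cl (n : ℕ) (t : ℤ) : Fin (n + 1) := ⟨(min (max t 0) n).toNat, by omega⟩

lemma zero_mem_PF {n : ℕ} (x : Fin (n + 1) → V) (S : Finset ℕ) : x 0 ∈ PF x S :=
  subset_convexHull ℝ _ ⟨0, Or.inl rfl, rfl⟩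

lemma PF_mono {n : ℕ} (x : Fin (n + 1) → V) {S T : Finset ℕ} (h : S ⊆ T) : PF x S ⊆ PF x T :=
  convexHull_mono (Set.image_mono fun _ hi => hi.imp id (fun q => h q))

lemma T_eq (d n : ℕ) (hd : 3 ≤ d) (hn : d ≤ n) (x : Fin (n + 1) → V) :
    convexHull ℝ (Tset d x 0) = PF x (perp (d - 2) n {1}) := by
  have h : Tset d x 0 = x '' (cl n '' Set.Icc 0 (0 + (d : ℤ) - 1)) := by
    rw [Set.image_image]; rfl
  rw [PF, h]
  congr 2
  ext k
  simp only [Set.mem_image, Set.mem_Icc, Set.mem_setOf_eq, mem_perp, Finset.mem_singleton,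
    forall_eq, BR, cl, Fin.ext_iff, Fin.val_zero, true_or, implies_true, and_true]
  have hk := k.2
  constructor
  · rintro ⟨t, ht, he⟩
    omega
  · intro h
    exact ⟨(k : ℕ), by omega, by omega⟩

lemma E_eq (d n : ℕ) (hd : 3 ≤ d) (hn : d ≤ n) (x : Fin (n + 1) → V) (j : ℕ) (hj : 2 ≤ j)
    (hjn : j ≤ n) :
    convexHull ℝ (Eset d x j) = PF x (perp (d - 2) n {j}) := by
  have h : Eset d x j = x '' (insert 0 (cl n '' (Set.Icc ((j : ℤ) - ((d : ℤ) - 2))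
      (j + ((d : ℤ) - 2)) \ {(j : ℤ)}))) := by
    rw [Set.image_insert_eq, Set.image_image]; rfl
  rw [PF, h]
  congr 2
  ext k
  simp only [Set.mem_insert_iff, Set.mem_image, Set.mem_diff, Set.mem_singleton_iff, Set.mem_Icc,
    Set.mem_setOf_eq, mem_perp, Finset.mem_singleton,
    forall_eq, BR, cl, Fin.ext_iff, Fin.val_zero]
  have hk := k.2
  constructor
  · rintro (h | ⟨t, ht, he⟩)
    · exact Or.inl h
    · omega
  · rintro (h | h)
    · exact Or.inl h
    · right
      by_cases hkj : (k : ℕ) = j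
      · exact ⟨j + 1, by omega, by omega⟩
      · exact ⟨(k : ℕ), by omega, by omega⟩

lemma facet_PF {d n : ℕ} (hd : 3 ≤ d) {x : Fin (n + 1) → V} (hx : IsBraxtope d n x)
    {a : ℕ} (h1 : 1 ≤ a) (h2 : a ≤ n) : IsFacetOf d (braxQ x) (PF x (perp (d - 2) n {a})) := by
  obtain ⟨hn, hinj, hdim, hext, hfac⟩ := hx.2 hd
  rw [hfac]
  by_cases ha : a = 1
  · subst ha
    exact Or.inl ⟨0, le_rfl, by omega, (T_eq d n hd hn x).symm⟩
  · exact Or.inr ⟨a, by omega, by omega, (E_eq d n hd hn x a (by omega) h2).symm⟩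

lemma facet_cases {d n : ℕ} (hd : 3 ≤ d) {x : Fin (n + 1) → V} (hx : IsBraxtope d n x)
    {G : Set V} (hG : IsFacetOf d (braxQ x) G) (h0 : x 0 ∈ G) :
    ∃ a, (1 ≤ a ∧ a ≤ n) ∧ G = PF x (perp (d - 2) n {a}) := by
  obtain ⟨hn, hinj, hdim, hext, hfac⟩ := hx.2 hd
  rcases (hfac G).1 hG with ⟨i, hi0, hi1, rfl⟩ | ⟨j, hj0, hj1, rfl⟩
  · have h : Tset d x i = x '' (cl n '' Set.Icc i (i + (d : ℤ) - 1)) := by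
      rw [Set.image_image]; rfl
    rw [h, mem_hull_iff hinj hext] at h0
    obtain ⟨t, ht, he⟩ := h0
    simp only [cl, Fin.ext_iff, Fin.val_zero, Set.mem_Icc] at ht he
    have : i = 0 := by omega
    subst this
    exact ⟨1, by omega, T_eq d n hd hn x⟩
  · lift j to ℕ using by omega
    exact ⟨j, by omega, E_eq d n hd hn x j (by omega) (by omega)⟩

lemma mem_PF {d n : ℕ} (hd : 3 ≤ d) {x : Fin (n + 1) → V} (hx : IsBraxtope d n x)
    (S : Finset ℕ) (i : Fin (n + 1)) : x i ∈ PF x S ↔ i = 0 ∨ (i : ℕ) ∈ S := by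
  obtain ⟨hn, hinj, hdim, hext, hfac⟩ := hx.2 hd
  rw [PF, mem_hull_iff hinj hext]; rfl

lemma PF_inj {d n : ℕ} (hd : 3 ≤ d) {x : Fin (n + 1) → V} (hx : IsBraxtope d n x)
    {S T : Finset ℕ} (hS : S ⊆ Finset.Icc 1 n) (hT : T ⊆ Finset.Icc 1 n)
    (h : PF x S = PF x T) : S = T := by
  have key : ∀ i, 1 ≤ i → i ≤ n → (i ∈ S ↔ i ∈ T) := by
    intro i h1 h2
    have a1 := mem_PF hd hx S ⟨i, by omega⟩
    have a2 := mem_PF hd hx T ⟨i, by omega⟩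
    rw [h] at a1
    have : (⟨i, by omega⟩ : Fin (n + 1)) ≠ 0 := by simp [Fin.ext_iff]; omega
    simp only [this, false_or] at a1 a2
    rw [← a1, ← a2]
  ext i
  constructor
  · intro hi
    have := Finset.mem_Icc.1 (hS hi)
    exact (key i this.1 this.2).1 hi
  · intro hi
    have := Finset.mem_Icc.1 (hT hi)
    exact (key i this.1 this.2).2 hi

lemma face_perp {d n : ℕ} (hd : 3 ≤ d) {x : Fin (n + 1) → V} (hx : IsBraxtope d n x)
    {A : Finset ℕ} (hA : A ⊆ Finset.Icc 1 n) (hne : A.Nonempty) :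
    IsFaceOf (braxQ x) (PF x (perp (d - 2) n A)) := by
  have hfa : ∀ a : A, IsFaceOf (braxQ x) (PF x (perp (d - 2) n {(a : ℕ)})) := fun a =>
    (facet_PF hd hx (Finset.mem_Icc.1 (hA a.2)).1 (Finset.mem_Icc.1 (hA a.2)).2).1
  have : Nonempty A := hne.to_subtype
  let G : Set V := ⋂ a : A, PF x (perp (d - 2) n {(a : ℕ)})
  have hGE : IsExtreme ℝ (braxQ x) G := isExtreme_iInter fun a => (hfa a).1
  have hGc : Convex ℝ G := convex_iInter fun a => (hfa a).2.1
  have hGcl : IsClosed G := isClosed_iInter fun a => (hfa a).2.2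
  have h0 : x 0 ∈ G := Set.mem_iInter.2 fun a => zero_mem_PF x _
  have hG := face_eq_hull_s13 x hGE hGc h0
  have : G = PF x (perp (d - 2) n A) := by
    rw [hG, PF]
    congr 2
    ext i
    simp only [G, Set.mem_setOf_eq, Set.mem_iInter, mem_PF hd hx, mem_perp, Finset.mem_singleton,
      forall_eq, Subtype.forall]
    by_cases hi : i = 0
    · simp [hi]
    · simp only [hi, false_or]
      constructor
      · intro h
        exact ⟨(h _ hne.choose_spec).1, fun a ha => (h a ha).2⟩
      · exact fun h a ha => ⟨h.1, h.2 a ha⟩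
  rw [← this]
  exact ⟨hGE, hGc, hGcl⟩

lemma face_win {d n : ℕ} (hd : 3 ≤ d) (hn : d ≤ n) {x : Fin (n + 1) → V}
    (hx : IsBraxtope d n x) {S : Finset ℕ} (hS : Win (d - 2) n S) :
    IsFaceOf (braxQ x) (PF x S) := by
  rw [← perp_perp (by omega) (by omega) hS]
  exact face_perp hd hx perp_subset (perp_nonempty (by omega) (by omega) hS)

lemma face_classify {d n : ℕ} (hd : 3 ≤ d) {x : Fin (n + 1) → V}
    (hx : IsBraxtope d n x) {F : Set V} (hF : IsFaceOf (braxQ x) F) (h0 : x 0 ∈ F)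
    (hne : sdim F < d) :
    ∃ A : Finset ℕ, A ⊆ Finset.Icc 1 n ∧ A.Nonempty ∧ F = PF x (perp (d - 2) n A) := by
  classical
  obtain ⟨hn, hinj, hdim, hext, hfac⟩ := hx.2 hd
  let A : Finset ℕ := (Finset.Icc 1 n).filter fun a => F ⊆ PF x (perp (d - 2) n {a})
  have hsep : ∀ i, x i ∉ F → ∃ a ∈ A, x i ∉ PF x (perp (d - 2) n {a}) := by
    intro i hi
    obtain ⟨G, hG, hFG, hiG⟩ := exists_facet_s13 x hdim hF h0 i hi
    obtain ⟨a, ha, rfl⟩ := facet_cases hd hx hG (hFG h0)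
    exact ⟨a, by simp [A, ha, hFG], hiG⟩
  have hAne : A.Nonempty := by
    have : ∃ i, x i ∉ F := by
      by_contra hall
      push Not at hall
      have : F = braxQ x := hF.1.1.antisymm
        (convexHull_min (by rintro _ ⟨i, rfl⟩; exact hall i) hF.2.1)
      rw [this, hdim] at hne
      exact lt_irrefl _ hne
    obtain ⟨i, hi⟩ := this
    obtain ⟨a, ha, _⟩ := hsep i hi
    exact ⟨a, ha⟩
  refine ⟨A, Finset.filter_subset _ _, hAne, ?_⟩
  rw [face_eq_hull_s13 x hF.1 hF.2.1 h0, PF]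
  congr 2
  ext i
  simp only [Set.mem_setOf_eq]
  constructor
  · intro hi
    by_cases hi0 : i = 0
    · exact Or.inl hi0
    right
    have : ∀ a ∈ A, (i : ℕ) ∈ perp (d - 2) n {a} := by
      intro a ha
      have := (Finset.mem_filter.1 ha).2 hi
      rw [mem_PF hd hx] at this
      exact this.resolve_left hi0
    rw [mem_perp]
    refine ⟨(mem_perp.1 (this _ hAne.choose_spec)).1, fun a ha => ?_⟩
    exact (mem_perp.1 (this a ha)).2 a (Finset.mem_singleton_self a)
  · intro h
    by_contra hi
    obtain ⟨a, ha, hia⟩ := hsep i hi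
    apply hia
    rw [mem_PF hd hx]
    refine h.imp id fun h => ?_
    exact perp_anti (Finset.singleton_subset_iff.2 ha) h

lemma sdim_win_ge {d n : ℕ} (hd : 3 ≤ d) (hn : d ≤ n) {x : Fin (n + 1) → V}
    (hx : IsBraxtope d n x) (S : Finset ℕ) (hS : Win (d - 2) n S) :
    (S.card : ℤ) ≤ sdim (PF x S) := by
  induction S using Finset.induction_on with
  | empty =>
    rw [sdim, if_pos ⟨_, zero_mem_PF x _⟩]; simp
  | insert a S ha ih =>
    have hS' := hS.mono (Finset.subset_insert a S)
    have h1 := ih hS'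
    have h2 := sdim_strict x (face_win hd hn hx hS') (face_win hd hn hx hS) ⟨_, zero_mem_PF x _⟩
      (PF_mono x (Finset.subset_insert a S)) (fun h => by
        have := PF_inj hd hx hS'.1 hS.1 h
        exact ha (this ▸ Finset.mem_insert_self a S))
    rw [Finset.card_insert_of_notMem ha]
    push_cast
    linarith

lemma sdim_win {d n : ℕ} (hd : 3 ≤ d) (hn : d ≤ n) {x : Fin (n + 1) → V}
    (hx : IsBraxtope d n x) (S : Finset ℕ) (hS : Win (d - 2) n S) :
    sdim (PF x S) = S.card := by
  classical
  refine le_antisymm ?_ (sdim_win_ge hd hn hx S hS)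
  rw [sdim, if_pos ⟨_, zero_mem_PF x _⟩, PF, affineSpan_convexHull, direction_affineSpan]
  have h0 : 0 ∉ S := fun h => by have := Finset.mem_Icc.1 (hS.1 h); omega
  have hset : x '' {i | i = 0 ∨ (i : ℕ) ∈ S} =
      ((insert 0 S).image (fun t : ℕ => x (cl n t)) : Finset V) := by
    ext y
    simp only [Set.mem_image, Set.mem_setOf_eq, Finset.coe_image, Finset.mem_coe,
      Finset.mem_insert]
    constructor
    · rintro ⟨i, hi, rfl⟩
      refine ⟨i, hi.imp (fun h => by simp [h]) id, ?_⟩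
      congr 1
      have := i.2
      simp only [cl, Fin.ext_iff]; omega
    · rintro ⟨t, ht, rfl⟩
      refine ⟨_, ?_, rfl⟩
      simp only [cl, Fin.ext_iff, Fin.val_zero]
      rcases ht with rfl | ht
      · left; omega
      · right
        have := Finset.mem_Icc.1 (hS.1 ht)
        have e : (min (max (t : ℤ) 0) n).toNat = t := by omega
        rwa [e]
  rw [hset]
  exact_mod_cast finrank_vectorSpan_image_finset_le ℝ (fun t : ℕ => x (cl n t)) (insert 0 S)
    (Finset.card_insert_of_notMem h0)

lemma sdim_perp_chain {d n : ℕ} (hd : 3 ≤ d) (hn : d ≤ n) {x : Fin (n + 1) → V}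
    (hx : IsBraxtope d n x) {A : Finset ℕ} (hne : A.Nonempty) (C : Finset ℕ) (hAC : Disjoint A C)
    (hW : Win (d - 2) n (A ∪ C)) :
    sdim (PF x (perp (d - 2) n (A ∪ C))) + C.card ≤ sdim (PF x (perp (d - 2) n A)) := by
  induction C using Finset.induction_on with
  | empty => simp
  | insert c C hc ih =>
    have hsub : A ∪ C ⊆ A ∪ insert c C :=
      Finset.union_subset_union_right (Finset.subset_insert c C)
    have hW' := hW.mono hsub
    have hd' : Disjoint A C := hAC.mono_right (Finset.subset_insert c C)
    have h1 := ih hd' hW'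
    have hneq : A ∪ C ≠ A ∪ insert c C := by
      intro h
      have : c ∈ A ∪ C := by rw [h]; simp
      rcases Finset.mem_union.1 this with h | h
      · exact Finset.disjoint_left.1 hAC h (Finset.mem_insert_self c C)
      · exact hc h
    have h2 := sdim_strict x
      (face_perp hd hx hW.1 (hne.mono Finset.subset_union_left))
      (face_perp hd hx hW'.1 (hne.mono Finset.subset_union_left)) ⟨_, zero_mem_PF x _⟩
      (PF_mono x (perp_anti hsub)) (fun h => by
        have := PF_inj hd hx perp_subset perp_subset h
        apply hneq
        rw [← perp_perp (by omega) (by omega) hW, ← perp_perp (by omega) (by omega) hW', this])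
    rw [Finset.card_insert_of_notMem hc]
    push_cast
    linarith

lemma sdim_perp {d n : ℕ} (hd : 3 ≤ d) (hn : d ≤ n) {x : Fin (n + 1) → V}
    (hx : IsBraxtope d n x) {A : Finset ℕ} (hA : Win (d - 2) n A) (hne : A.Nonempty) :
    sdim (PF x (perp (d - 2) n A)) = (d : ℤ) - A.card := by
  have chain : ∀ A B : Finset ℕ, A.Nonempty → A ⊆ B → Win (d - 2) n B →
      sdim (PF x (perp (d - 2) n B)) + ((B.card : ℤ) - A.card) ≤
        sdim (PF x (perp (d - 2) n A)) := by
    intro A B hne hAB hB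
    have e : A ∪ (B \ A) = B := Finset.union_sdiff_of_subset hAB
    have := sdim_perp_chain hd hn hx hne (B \ A) Finset.disjoint_sdiff (by rwa [e])
    rw [e] at this
    have hc := Finset.card_sdiff_add_card_eq_card hAB
    have hc' : ((B \ A).card : ℤ) + A.card = B.card := by exact_mod_cast hc
    linarith
  apply le_antisymm
  · obtain ⟨a, ha⟩ := hne
    have h1 := chain {a} A ⟨a, by simp⟩ (by simpa using ha) hA
    have ha' := Finset.mem_Icc.1 (hA.1 ha)
    have h2 := (facet_PF hd hx ha'.1 ha'.2).2
    rw [h2] at h1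
    simp at h1
    linarith
  · obtain ⟨B, hB, hAB, hBc⟩ := hA.extend (by omega) (by omega) hne
    have h1 := chain A B hne hAB hB
    have hBne := hne.mono hAB
    have hnw := perp_not_win (by omega) (by omega) hB hBne
    obtain ⟨p, hp⟩ := perp_nonempty (by omega) (by omega) hB
    have hpI := perp_subset hp
    have hpw : Win (d - 2) n {p} := ⟨by simpa using hpI, by simp; omega⟩
    have h2 := sdim_win hd hn hx {p} hpw
    have h3 := sdim_strict x (face_win hd hn hx hpw) (face_perp hd hx hB.1 hBne)
      ⟨_, zero_mem_PF x _⟩ (PF_mono x (by simpa using hp)) (fun h => by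
        have := PF_inj hd hx hpw.1 perp_subset h
        exact hnw (this ▸ hpw))
    rw [h2] at h3
    simp at h3
    have : (B.card : ℤ) = (d : ℤ) - 2 := by omega
    linarith

/-- The number of `j`-faces of the `d`-braxtope containing the vertex `x_0`
is `C(d, j) + (n-d) C(d-2, j-1)`, for `0 ≤ j ≤ d - 1`. -/
theorem braxtope_faces_through_x0 (d n : ℕ) (hd : 3 ≤ d) (hn : d ≤ n)
    (x : Fin (n + 1) → V) (hx : IsBraxtope d n x)
    (j : ℤ) (hj0 : 0 ≤ j) (hjd : j ≤ (d : ℤ) - 1) :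
    ({F : Set V | IsFaceOf (braxQ x) F ∧ sdim F = j ∧ x 0 ∈ F}.ncard : ℤ) =
      zchoose (d : ℤ) j + ((n : ℤ) - d) * zchoose ((d : ℤ) - 2) (j - 1) := by

  classical
  lift j to ℕ using hj0
  have hw1 : 1 ≤ d - 2 := by omega
  have hw2 : d - 2 + 2 ≤ n := by omega
  rw [← count_final d n j hd hn (by omega)]
  have hset : {F : Set V | IsFaceOf (braxQ x) F ∧ sdim F = (j : ℤ) ∧ x 0 ∈ F} =
      PF x '' ((WinF (d - 2) n j ∪ (WinF (d - 2) n (d - j)).image (perp (d - 2) n) :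
        Finset (Finset ℕ)) : Set (Finset ℕ)) := by
    ext F
    simp only [Set.mem_setOf_eq, Set.mem_image, Finset.mem_coe, Finset.mem_union, mem_WinF,
      Finset.mem_image]
    constructor
    · rintro ⟨hF, hdF, h0⟩
      obtain ⟨A, hA, hne, rfl⟩ := face_classify hd hx hF h0 (by omega)
      refine ⟨_, ?_, rfl⟩
      rcases perp_cases hw1 hw2 hA hne with h | h
      · right
        refine ⟨A, ⟨h, ?_⟩, rfl⟩
        rw [sdim_perp hd hn hx h hne] at hdF
        omega
      · left
        rw [sdim_win hd hn hx _ h] at hdF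
        exact ⟨h, by omega⟩
    · rintro ⟨S, ⟨hS, hc⟩ | ⟨A, ⟨hA, hc⟩, rfl⟩, rfl⟩
      · exact ⟨face_win hd hn hx hS, by rw [sdim_win hd hn hx _ hS, hc], zero_mem_PF x _⟩
      · have hne : A.Nonempty := Finset.card_pos.1 (by omega)
        refine ⟨face_perp hd hx hA.1 hne, ?_, zero_mem_PF x _⟩
        rw [sdim_perp hd hn hx hA hne]
        omega
  rw [hset, Set.ncard_image_of_injOn, Set.ncard_coe_finset, Finset.card_union_of_disjoint,
    Finset.card_image_of_injOn]
  · intro A hA B hB h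
    rw [← perp_perp hw1 hw2 (mem_WinF.1 hA).1, ← perp_perp hw1 hw2 (mem_WinF.1 hB).1]
    exact congrArg _ h
  · rw [Finset.disjoint_left]
    intro S hS hS'
    obtain ⟨A, hA, rfl⟩ := Finset.mem_image.1 hS'
    obtain ⟨hA1, hA2⟩ := mem_WinF.1 hA
    exact perp_not_win hw1 hw2 hA1 (Finset.card_pos.1 (by omega)) (mem_WinF.1 hS).1
  · have hsub : ∀ S ∈ ((WinF (d - 2) n j ∪ (WinF (d - 2) n (d - j)).image (perp (d - 2) n) :
        Finset (Finset ℕ)) : Set (Finset ℕ)), S ⊆ Finset.Icc 1 n := by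
      intro S hS
      simp only [Finset.mem_coe, Finset.mem_union, mem_WinF, Finset.mem_image] at hS
      rcases hS with ⟨hS, _⟩ | ⟨A, _, rfl⟩
      · exact hS.1
      · exact perp_subset
    intro S hS T hT h
    exact PF_inj hd hx (hsub S hS) (hsub T hT) h
end
end
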